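/- Let k ≤ n and j ≤ n be positive integers. Let Q be a random matrix distributed according to the Haar probability measure on the Stiefel manifold V_k^n, and let L_j denote the linear map on n × k matrices that restricts a matrix to its first j rows and rescales the result by √(n/j). Then E ‖L_j(Q)‖ ≤ (1 + k/(2n)) · (1 + √(k/j)), where ‖·‖ denotes the spectral norm of a j × k matrix. -/

import Mathlib

open MeasureTheory ProbabilityTheory Matrix

/-- The space of `n × k` real matrices carries the product measurable structure. -/
instance matrixMeasurableSpace (n k : ℕ) : MeasurableSpace (Matrix (Fin n) (Fin k) ℝ) :=
  MeasurableSpace.pi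

/-- The Euclidean (ℓ₂) norm of a vector in `ℝ^m`. -/
noncomputable def euclNorm {m : ℕ} (v : Fin m → ℝ) : ℝ :=
  Real.sqrt (∑ i, v i ^ 2)

/-- The spectral norm of an `a × b` real matrix: its operator norm `ℓ₂^b → ℓ₂^a`. -/
noncomputable def specNorm {a b : ℕ} (M : Matrix (Fin a) (Fin b) ℝ) : ℝ :=
  sSup {r : ℝ | ∃ x : Fin b → ℝ, euclNorm x ≤ 1 ∧ r = euclNorm (M.mulVec x)}

/-- The map `L_j` restricting an `n × k` matrix to its first `j` rows and rescaling by
`√(n/j)`. -/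
noncomputable def restrictRows {n k : ℕ} (j : ℕ) (hj : j ≤ n)
    (M : Matrix (Fin n) (Fin k) ℝ) : Matrix (Fin j) (Fin k) ℝ :=
  Real.sqrt ((n : ℝ) / (j : ℝ)) • M.submatrix (Fin.castLE hj) id

section Gaussian

open scoped RealInnerProductSpace

variable {E : Type*} [NormedAddCommGroup E] [InnerProductSpace ℝ E] [FiniteDimensional ℝ E]
  [MeasurableSpace E] [BorelSpace E]

/-- A linear map whose adjoint is isometric pushes the standard Gaussian measure to the standard
Gaussian measure. -/
lemma map_stdGaussian_of_adjoint_isometry {F : Type*} [NormedAddCommGroup F]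
    [InnerProductSpace ℝ F] [FiniteDimensional ℝ F] [MeasurableSpace F] [BorelSpace F]
    (T : E →L[ℝ] F) (S : F → E) (hTS : ∀ x t, ⟪T x, t⟫ = ⟪x, S t⟫) (hS : ∀ t, ‖S t‖ = ‖t‖) :
    (stdGaussian E).map T = stdGaussian F := by
  have : IsProbabilityMeasure ((stdGaussian E).map T) :=
    Measure.isProbabilityMeasure_map T.continuous.aemeasurable
  apply Measure.ext_of_charFun
  ext t
  rw [charFun_stdGaussian, charFun_apply, integral_map T.continuous.aemeasurable
    (Measurable.aestronglyMeasurable (by fun_prop))]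
  simp_rw [hTS]
  rw [← charFun_apply, charFun_stdGaussian, hS]

lemma stdGaussian_eq_withDensity :
    stdGaussian E = (volume : Measure E).withDensity (fun x ↦ ENNReal.ofReal
      ((2 * Real.pi) ^ (-(Module.finrank ℝ E : ℝ) / 2) * Real.exp (-(1 / 2) * ‖x‖ ^ 2))) := by
  set c : ℝ := (2 * Real.pi) ^ (-(Module.finrank ℝ E : ℝ) / 2) with hc
  have hc0 : 0 < c := by positivity
  have h_int : Integrable (fun x : E ↦ c * Real.exp (-(1 / 2) * ‖x‖ ^ 2)) := by
    have := (GaussianFourier.integrable_cexp_neg_mul_sq_norm_add (V := E) (b := 1 / 2)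
      (by norm_num) 0 0).re
    refine (Integrable.const_mul this c).congr (.of_forall fun x ↦ ?_)
    simp only [zero_mul, add_zero]
    congr 1
    have : -(1 / 2 : ℂ) * (‖x‖ : ℂ) ^ 2 = ((-(1 / 2) * ‖x‖ ^ 2 : ℝ) : ℂ) := by push_cast; ring
    rw [this, ← Complex.ofReal_exp]
    rfl
  have : IsFiniteMeasure ((volume : Measure E).withDensity (fun x ↦ ENNReal.ofReal
      (c * Real.exp (-(1 / 2) * ‖x‖ ^ 2)))) := isFiniteMeasure_withDensity_ofReal h_int.2
  apply Measure.ext_of_charFun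
  ext t
  rw [charFun_stdGaussian, charFun_apply, integral_withDensity_eq_integral_toReal_smul
    (by fun_prop) (by simp)]
  have h := GaussianFourier.integral_cexp_neg_mul_sq_norm_add (V := E) (b := 1 / 2)
      (by norm_num) Complex.I t
  have h2 : ∀ x : E, (ENNReal.ofReal (c * Real.exp (-(1 / 2) * ‖x‖ ^ 2))).toReal •
      Complex.exp (⟪x, t⟫ * Complex.I) =
      c * Complex.exp (-(1 / 2) * ‖x‖ ^ 2 + Complex.I * ⟪t, x⟫) := by
    intro x
    rw [ENNReal.toReal_ofReal (by positivity), Complex.exp_add, Complex.real_smul]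
    push_cast
    rw [real_inner_comm, mul_comm Complex.I, mul_assoc]
  simp_rw [h2]
  rw [integral_const_mul, h]
  have h3 : (Real.pi / (1 / 2 : ℂ)) ^ (Module.finrank ℝ E / 2 : ℂ) =
      (((2 * Real.pi) ^ ((Module.finrank ℝ E : ℝ) / 2) : ℝ) : ℂ) := by
    rw [Complex.ofReal_cpow (by positivity)]
    push_cast
    congr 1
    ring
  rw [h3, ← mul_assoc, ← Complex.ofReal_mul, hc, ← Real.rpow_add (by positivity)]
  have h4 : -(Module.finrank ℝ E : ℝ) / 2 + (Module.finrank ℝ E : ℝ) / 2 = 0 := by ring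
  rw [h4]
  simp only [Real.rpow_zero, Complex.ofReal_one, one_mul, Complex.I_sq]
  congr 1
  ring

lemma integral_stdGaussian (f : E → ℝ) :
    ∫ x, f x ∂(stdGaussian E) = (2 * Real.pi) ^ (-(Module.finrank ℝ E : ℝ) / 2) *
      ∫ x, f x * Real.exp (-(1 / 2) * ‖x‖ ^ 2) := by
  rw [stdGaussian_eq_withDensity, integral_withDensity_eq_integral_toReal_smul
    (by fun_prop) (by simp), ← integral_const_mul]
  congr 1 with x
  rw [ENNReal.toReal_ofReal (by positivity), smul_eq_mul]
  ring

lemma integrable_stdGaussian_iff (f : E → ℝ) :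
    Integrable f (stdGaussian E) ↔ Integrable (fun x ↦ f x * Real.exp (-(1 / 2) * ‖x‖ ^ 2)) := by
  rw [stdGaussian_eq_withDensity, integrable_withDensity_iff_integrable_smul₀' (by fun_prop)
    (by simp)]
  have : (2 * Real.pi) ^ (-(Module.finrank ℝ E : ℝ) / 2) ≠ 0 := by positivity
  rw [← integrable_const_mul_iff (isUnit_iff_ne_zero.2 this)
    (fun x ↦ f x * Real.exp (-(1 / 2) * ‖x‖ ^ 2))]
  refine integrable_congr (.of_forall fun x ↦ ?_)
  simp only
  rw [ENNReal.toReal_ofReal (by positivity), smul_eq_mul]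
  ring

/-- Gaussian integration by parts. -/
lemma integral_inner_mul_stdGaussian {f : E → ℝ} (hf : Differentiable ℝ f) (a : E)
    {C D : ℝ} (hfC : ∀ x, |f x| ≤ C) (hfD : ∀ x, |fderiv ℝ f x a| ≤ D)
    (hcont : Continuous fun x ↦ fderiv ℝ f x a) :
    ∫ x, ⟪a, x⟫ * f x ∂(stdGaussian E) = ∫ x, fderiv ℝ f x a ∂(stdGaussian E) := by
  have hder : ∀ x : E, HasFDerivAt (fun x : E ↦ Real.exp (-(1 / 2) * ‖x‖ ^ 2))
      (-Real.exp (-(1 / 2) * ‖x‖ ^ 2) • innerSL ℝ x) x := by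
    intro x
    have := ((hasStrictFDerivAt_norm_sq x).hasFDerivAt.const_mul (-(1 / 2) : ℝ)).exp
    convert this using 1
    ext y
    simp
  have h1 : Integrable (fun x ↦ ⟪a, x⟫ * f x) (stdGaussian E) :=
    ((IsGaussian.integrable_id (μ := stdGaussian E)).const_inner a).mul_bdd (c := C)
      hf.continuous.aestronglyMeasurable (.of_forall hfC)
  have h2 : Integrable (fun x ↦ fderiv ℝ f x a) (stdGaussian E) :=
    Integrable.of_bound hcont.aestronglyMeasurable D (.of_forall hfD)
  have h3 : Integrable f (stdGaussian E) :=
    Integrable.of_bound hf.continuous.aestronglyMeasurable C (.of_forall hfC)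
  rw [integrable_stdGaussian_iff] at h1 h2 h3
  have := integral_mul_fderiv_eq_neg_fderiv_mul_of_integrable (μ := (volume : Measure E))
    (f := f) (g := fun x : E ↦ Real.exp (-(1 / 2) * ‖x‖ ^ 2)) (v := a) h2 ?_ h3
    (fun x _ ↦ hf x) (fun x _ ↦ (hder x).differentiableAt)
  · rw [integral_stdGaussian, integral_stdGaussian, ← neg_neg (∫ x, fderiv ℝ f x a * _), ← this,
      ← integral_neg]
    congr 2 with x
    rw [(hder x).fderiv]
    simp only [_root_.smul_apply, innerSL_apply_apply, smul_eq_mul, neg_mul, real_inner_comm x a]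
    ring
  · refine h1.neg.congr (.of_forall fun x ↦ ?_)
    simp only [Pi.neg_apply]
    rw [(hder x).fderiv]
    simp only [_root_.smul_apply, innerSL_apply_apply, smul_eq_mul, neg_mul, real_inner_comm x a]
    ring

lemma integral_norm_sq_stdGaussian :
    ∫ x, ‖x‖ ^ 2 ∂(stdGaussian E) = Module.finrank ℝ E := by
  have h : ∀ x : E, ‖x‖ ^ 2 = ∑ i, ⟪stdOrthonormalBasis ℝ E i, x⟫ ^ 2 := fun x ↦
    ((stdOrthonormalBasis ℝ E).sum_sq_inner_right x).symm
  have hm : ∀ a : E, MemLp (fun x : E ↦ ⟪a, x⟫) 2 (stdGaussian E) := fun a ↦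
    (IsGaussian.memLp_two_id (μ := stdGaussian E)).const_inner a
  simp_rw [h]
  rw [integral_finsetSum _ fun i _ ↦ (hm _).integrable_sq]
  have : ∀ i, ∫ x, ⟪stdOrthonormalBasis ℝ E i, x⟫ ^ 2 ∂(stdGaussian E) = 1 := by
    intro i
    have h1 := variance_dual_stdGaussian (innerSL ℝ (stdOrthonormalBasis ℝ E i))
    rw [variance_of_integral_eq_zero (by fun_prop) (integral_strongDual_stdGaussian _)] at h1
    simpa using h1
  simp [this]

lemma integral_norm_stdGaussian_le_sqrt :
    ∫ x, ‖x‖ ∂(stdGaussian E) ≤ √(Module.finrank ℝ E) := by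
  apply Real.le_sqrt_of_sq_le
  have hm : MemLp (fun x : E ↦ ‖x‖) 2 (stdGaussian E) :=
    (IsGaussian.memLp_two_id (μ := stdGaussian E)).norm
  have := variance_nonneg (fun x : E ↦ ‖x‖) (stdGaussian E)
  rw [variance_eq_sub hm] at this
  simp only [Pi.pow_apply, integral_norm_sq_stdGaussian] at this
  linarith

end Gaussian

/-- The mean of the chi distribution with `m` degrees of freedom. -/
noncomputable def chiMean (m : ℕ) : ℝ := √2 * Real.Gamma ((m + 1) / 2) / Real.Gamma (m / 2)

lemma integral_norm_stdGaussian {E : Type*} [NormedAddCommGroup E] [InnerProductSpace ℝ E]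
    [FiniteDimensional ℝ E] [MeasurableSpace E] [BorelSpace E]
    (h : 0 < Module.finrank ℝ E) :
    ∫ x, ‖x‖ ∂(stdGaussian E) = chiMean (Module.finrank ℝ E) := by
  have : Nontrivial E := Module.nontrivial_of_finrank_pos h
  have hI : ∀ m : ℕ, ∫ y in Set.Ioi (0 : ℝ), y ^ m * Real.exp (-(1 / 2) * y ^ 2) =
      (1 / 2 : ℝ) ^ (-((m : ℝ) + 1) / 2) * (1 / 2) * Real.Gamma ((m + 1) / 2) := by
    intro m
    rw [← integral_rpow_mul_exp_neg_mul_rpow (by norm_num) (by linarith [m.cast_nonneg (α := ℝ)])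
      (by norm_num)]
    simp
  have h1 := integral_stdGaussian (E := E) (fun _ ↦ 1)
  have h2 := integral_stdGaussian (E := E) (fun x ↦ ‖x‖)
  simp only [integral_const, probReal_univ, smul_eq_mul, mul_one, one_mul] at h1
  rw [integral_fun_norm_addHaar volume (fun y ↦ Real.exp (-(1 / 2) * y ^ 2))] at h1
  rw [integral_fun_norm_addHaar volume (fun y ↦ y * Real.exp (-(1 / 2) * y ^ 2))] at h2
  obtain ⟨d, hd⟩ : ∃ d, Module.finrank ℝ E = d + 1 := ⟨_, (Nat.sub_add_cancel h).symm⟩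
  simp only [hd, Nat.add_sub_cancel, smul_eq_mul, ← mul_assoc, ← pow_succ, nsmul_eq_mul] at h1 h2
  rw [hI] at h1 h2
  rw [h2, hd, chiMean, eq_div_iff (Real.Gamma_pos_of_pos (by positivity)).ne']
  push_cast at h1 h2 ⊢
  have h3 : (1 / 2 : ℝ) ^ (-((d : ℝ) + 1 + 1) / 2) = (1 / 2 : ℝ) ^ (-((d : ℝ) + 1) / 2) * √2 := by
    have : -((d : ℝ) + 1 + 1) / 2 = -((d : ℝ) + 1) / 2 + -(1 / 2) := by ring
    rw [this, Real.rpow_add (by norm_num), Real.rpow_neg (by norm_num) (1 / 2),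
      ← Real.sqrt_eq_rpow, ← Real.sqrt_inv]
    norm_num
  rw [h3]
  linear_combination (-√2 * Real.Gamma ((d + 1 + 1) / 2)) * h1

lemma chiMean_pos {m : ℕ} (hm : 0 < m) : 0 < chiMean m := by
  have : (0 : ℝ) < m := by exact_mod_cast hm
  have := Real.Gamma_pos_of_pos (s := (m + 1) / 2) (by positivity)
  have := Real.Gamma_pos_of_pos (s := m / 2) (by positivity)
  unfold chiMean
  positivity

lemma chiMean_mul_chiMean_succ {m : ℕ} (hm : 0 < m) : chiMean m * chiMean (m + 1) = m := by
  have : (0 : ℝ) < m := by exact_mod_cast hm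
  have h1 := Real.Gamma_pos_of_pos (s := (m + 1) / 2) (by positivity)
  have h2 := Real.Gamma_pos_of_pos (s := m / 2) (by positivity)
  have h3 : Real.Gamma ((m + 1 + 1) / 2) = m / 2 * Real.Gamma (m / 2) := by
    rw [← Real.Gamma_add_one (by positivity)]
    congr 1
    ring
  unfold chiMean
  push_cast
  rw [h3]
  field_simp
  norm_num

lemma chiMean_le_chiMean_succ {m : ℕ} (hm : 0 < m) : chiMean m ≤ chiMean (m + 1) := by
  have : (0 : ℝ) < m := by exact_mod_cast hm
  have h1 := Real.Gamma_pos_of_pos (s := (m + 1) / 2) (by positivity)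
  have h2 := Real.Gamma_pos_of_pos (s := m / 2) (by positivity)
  have h3 := Real.Gamma_pos_of_pos (s := (m + 1 + 1) / 2) (by positivity)
  have h := Real.Gamma_mul_add_mul_le_rpow_Gamma_mul_rpow_Gamma (s := m / 2) (t := (m + 1 + 1) / 2)
    (a := 1 / 2) (b := 1 / 2) (by positivity) (by positivity) (by norm_num) (by norm_num)
    (by norm_num)
  rw [show (1 / 2 * (m / 2) + 1 / 2 * ((m + 1 + 1) / 2) : ℝ) = (m + 1) / 2 by ring,
    ← Real.mul_rpow h2.le h3.le, ← Real.sqrt_eq_rpow, Real.le_sqrt h1.le (by positivity)] at h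
  unfold chiMean
  push_cast
  rw [div_le_div_iff₀ h2 h1]
  nlinarith [Real.sqrt_nonneg 2]

lemma sub_half_le_chiMean_sq {m : ℕ} (hm : 0 < m) : (m : ℝ) - 1 / 2 ≤ chiMean m ^ 2 := by
  have hm' : (1 : ℝ) ≤ m := by exact_mod_cast hm
  have step : ∀ {m : ℕ}, 0 < m → chiMean (m + 2) ^ 2 / ((m + 2 : ℕ) - 1 / 2 : ℝ) ≤
      chiMean m ^ 2 / ((m : ℝ) - 1 / 2) := by
    intro m hm
    have hm' : (1 : ℝ) ≤ m := by exact_mod_cast hm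
    have h1 := chiMean_mul_chiMean_succ hm
    have h2 := chiMean_mul_chiMean_succ (Nat.succ_pos m)
    have p1 := chiMean_pos hm
    have p2 := chiMean_pos (Nat.succ_pos m)
    push_cast [Nat.succ_eq_add_one] at h1 h2 p2 ⊢
    have h3 : m * chiMean (m + 2) = (m + 1) * chiMean m := by
      have : chiMean (m + 1) * (m * chiMean (m + 2)) = chiMean (m + 1) * ((m + 1) * chiMean m) := by
        linear_combination m * h2 - (m + 1) * h1
      exact mul_left_cancel₀ p2.ne' this
    have h4 : chiMean (m + 2) = (m + 1) / m * chiMean m := by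
      field_simp
      linarith
    rw [div_le_div_iff₀ (by linarith) (by linarith), h4, mul_pow, div_pow, div_mul_eq_mul_div,
      div_mul_eq_mul_div, div_le_iff₀ (by positivity)]
    have : ((m : ℝ) + 1) ^ 2 * (m - 1 / 2) ≤ (m + 2 - 1 / 2) * m ^ 2 := by nlinarith
    nlinarith [sq_nonneg (chiMean m)]
  have mono : ∀ i : ℕ, chiMean (m + 2 * i) ^ 2 / ((m + 2 * i : ℕ) - 1 / 2 : ℝ) ≤
      chiMean m ^ 2 / ((m : ℝ) - 1 / 2) := by
    intro i
    induction i with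
    | zero => simp
    | succ i ih => exact (step (m := m + 2 * i) (by lia)).trans ih
  have lower : ∀ {m : ℕ}, 0 < m → (m : ℝ) ≤ chiMean (m + 1) ^ 2 := by
    intro m hm
    rw [← chiMean_mul_chiMean_succ hm, sq]
    exact mul_le_mul_of_nonneg_right (chiMean_le_chiMean_succ hm) (chiMean_pos (by lia)).le
  have bound : ∀ i : ℕ, 1 - (1 / ((i : ℝ) + 1)) ≤ chiMean m ^ 2 / ((m : ℝ) - 1 / 2) := by
    intro i
    refine le_trans ?_ (mono (i + 1))
    have h1 := lower (m := m + 2 * i + 1) (by lia)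
    rw [show m + 2 * i + 1 + 1 = m + 2 * (i + 1) by ring] at h1
    push_cast at h1 ⊢
    rw [le_div_iff₀ (by linarith [i.cast_nonneg (α := ℝ)])]
    refine le_trans ?_ h1
    have : (0 : ℝ) < i + 1 := by positivity
    have h3 : (1 : ℝ) / (i + 1) * (m + 2 * (i + 1) - 1 / 2) ≥ 2 := by
      rw [ge_iff_le, div_mul_eq_mul_div, le_div_iff₀ this]
      linarith
    linarith
  have lim : Filter.Tendsto (fun i : ℕ ↦ 1 - (1 / ((i : ℝ) + 1))) Filter.atTop (nhds (1 - 0)) :=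
    tendsto_const_nhds.sub tendsto_one_div_add_atTop_nhds_zero_nat
  have := le_of_tendsto' lim bound
  rw [sub_zero, le_div_iff₀ (by linarith)] at this
  linarith

section Comparison

open scoped RealInnerProductSpace

variable {E : Type*} [NormedAddCommGroup E] [InnerProductSpace ℝ E]
  {I : Type*} [Fintype I]

/-- The log-sum-exp function of the linear functionals given by a family of vectors. -/
noncomputable def logSumExp (z : I → E) (x : E) : ℝ := Real.log (∑ i, Real.exp ⟪z i, x⟫)

/-- The softmax weights of the linear functionals given by a family of vectors. -/
noncomputable def softmax (z : I → E) (i : I) (x : E) : ℝ :=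
  Real.exp ⟪z i, x⟫ / ∑ l, Real.exp ⟪z l, x⟫

section

variable [Nonempty I]

lemma sum_exp_inner_pos (z : I → E) (x : E) : 0 < ∑ l, Real.exp ⟪z l, x⟫ :=
  Finset.sum_pos (fun _ _ ↦ Real.exp_pos _) Finset.univ_nonempty

lemma softmax_nonneg (z : I → E) (i : I) (x : E) : 0 ≤ softmax z i x := by
  unfold softmax; positivity

lemma sum_softmax (z : I → E) (x : E) : ∑ i, softmax z i x = 1 := by
  unfold softmax
  rw [← Finset.sum_div, div_self (sum_exp_inner_pos z x).ne']

lemma softmax_le_one (z : I → E) (i : I) (x : E) : softmax z i x ≤ 1 := by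
  rw [← sum_softmax z x]
  exact Finset.single_le_sum (fun l _ ↦ softmax_nonneg z l x) (Finset.mem_univ i)

lemma continuous_softmax (z : I → E) (i : I) : Continuous (softmax z i) := by
  unfold softmax
  exact Continuous.div (by fun_prop) (by fun_prop) fun x ↦ (sum_exp_inner_pos z x).ne'

lemma continuous_logSumExp (z : I → E) : Continuous (logSumExp z) := by
  unfold logSumExp
  exact Continuous.log (by fun_prop) fun x ↦ (sum_exp_inner_pos z x).ne'

lemma inner_le_logSumExp (z : I → E) (i : I) (x : E) : ⟪z i, x⟫ ≤ logSumExp z x := by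
  rw [logSumExp, Real.le_log_iff_exp_le (sum_exp_inner_pos z x)]
  exact Finset.single_le_sum (f := fun i ↦ Real.exp ⟪z i, x⟫) (fun l _ ↦ (Real.exp_pos _).le)
    (Finset.mem_univ i)

lemma logSumExp_le (z : I → E) (x : E) {B : ℝ} (h : ∀ i, ⟪z i, x⟫ ≤ B) :
    logSumExp z x ≤ B + Real.log (Fintype.card I) := by
  have hc : (0 : ℝ) < Fintype.card I := by exact_mod_cast Fintype.card_pos
  rw [logSumExp, Real.log_le_iff_le_exp (sum_exp_inner_pos z x), Real.exp_add, Real.exp_log hc]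
  calc ∑ i, Real.exp ⟪z i, x⟫ ≤ ∑ _i : I, Real.exp B :=
        Finset.sum_le_sum fun i _ ↦ Real.exp_le_exp.2 (h i)
    _ = _ := by simp [mul_comm]

lemma hasFDerivAt_softmax (z : I → E) (i : I) (x : E) :
    HasFDerivAt (softmax z i)
      (softmax z i x • (innerSL ℝ (z i) - ∑ l, softmax z l x • innerSL ℝ (z l))) x := by
  have h1 : ∀ l, HasFDerivAt (fun x ↦ Real.exp ⟪z l, x⟫)
      (Real.exp ⟪z l, x⟫ • innerSL ℝ (z l)) x := fun l ↦
    ((innerSL ℝ (z l)).hasFDerivAt).exp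
  have h2 : HasFDerivAt (fun x ↦ ∑ l, Real.exp ⟪z l, x⟫)
      (∑ l, Real.exp ⟪z l, x⟫ • innerSL ℝ (z l)) x := HasFDerivAt.fun_sum fun l _ ↦ h1 l
  have hS := (sum_exp_inner_pos z x).ne'
  have h3 := (h1 i).fun_mul ((hasDerivAt_inv hS).comp_hasFDerivAt x h2)
  refine (h3.congr_of_eventuallyEq (.of_forall fun x ↦ div_eq_mul_inv _ _)).congr_fderiv ?_
  ext y
  simp only [softmax, _root_.add_apply, Function.comp_apply, _root_.smul_apply,
    _root_.sub_apply, _root_.sum_apply, innerSL_apply_apply, smul_eq_mul, div_mul_eq_mul_div, ← Finset.sum_div]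
  field_simp
  ring

end

variable [FiniteDimensional ℝ E] [MeasurableSpace E] [BorelSpace E]

lemma integrable_inner_stdGaussian (a : E) : Integrable (fun x ↦ ⟪a, x⟫) (stdGaussian E) :=
  (IsGaussian.integrable_id (μ := stdGaussian E)).const_inner a

variable [Nonempty I]

lemma integrable_logSumExp (z : I → E) : Integrable (logSumExp z) (stdGaussian E) := by
  have h_int : Integrable (fun x ↦ ∑ i, |⟪z i, x⟫| + Real.log (Fintype.card I)) (stdGaussian E) :=
    (integrable_finsetSum _ fun i _ ↦ (integrable_inner_stdGaussian (z i)).abs).add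
      (integrable_const _)
  refine h_int.mono' (continuous_logSumExp z).aestronglyMeasurable (.of_forall fun x ↦ ?_)
  have hi : ∀ i, |⟪z i, x⟫| ≤ ∑ i, |⟪z i, x⟫| := fun i ↦
    Finset.single_le_sum (f := fun i ↦ |⟪z i, x⟫|) (fun _ _ ↦ abs_nonneg _) (Finset.mem_univ i)
  obtain ⟨i⟩ := ‹Nonempty I›
  have hc : 0 ≤ Real.log (Fintype.card I) := Real.log_natCast_nonneg _
  rw [Real.norm_eq_abs, abs_le]
  constructor
  · have := inner_le_logSumExp z i x
    have := neg_abs_le ⟪z i, x⟫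
    linarith [hi i]
  · exact logSumExp_le z x fun l ↦ (le_abs_self _).trans (hi l)

lemma integral_softmax_mul_inner (z : I → E) (i : I) (w : E) :
    ∫ x, softmax z i x * ⟪w, x⟫ ∂(stdGaussian E) =
      ∫ x, softmax z i x * (⟪z i, w⟫ - ∑ l, softmax z l x * ⟪z l, w⟫) ∂(stdGaussian E) := by
  have hder : ∀ x, fderiv ℝ (softmax z i) x w =
      softmax z i x * (⟪z i, w⟫ - ∑ l, softmax z l x * ⟪z l, w⟫) := by
    intro x
    rw [(hasFDerivAt_softmax z i x).fderiv]
    simp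
  have h := integral_inner_mul_stdGaussian (f := softmax z i)
    (fun x ↦ (hasFDerivAt_softmax z i x).differentiableAt) w (C := 1)
    (D := 1 * (|⟪z i, w⟫| + ∑ l, 1 * |⟪z l, w⟫|)) ?_ ?_ ?_
  · simp_rw [hder] at h
    simp_rw [← h, mul_comm]
  · intro x
    rw [abs_of_nonneg (softmax_nonneg z i x)]
    exact softmax_le_one z i x
  · intro x
    rw [hder, abs_mul, abs_of_nonneg (softmax_nonneg z i x)]
    gcongr
    · exact softmax_le_one z i x
    · refine (abs_sub _ _).trans ?_
      gcongr
      refine (Finset.abs_sum_le_sum_abs _ _).trans ?_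
      gcongr with l
      rw [abs_mul, abs_of_nonneg (softmax_nonneg z l x)]
      gcongr
      exact softmax_le_one z l x
  · simp_rw [hder]
    have := continuous_softmax z
    fun_prop

/-- Gaussian comparison for the log-sum-exp function. -/
lemma integral_logSumExp_le_of_inner_le {a b : I → E} {κ : ℝ} (hab : ∀ i l, ⟪a i, b l⟫ = 0)
    (hdiag : ∀ i, ⟪b i, b i⟫ - ⟪a i, a i⟫ = κ) (hle : ∀ i l, ⟪b i, b l⟫ - ⟪a i, a l⟫ ≤ κ) :
    ∫ x, logSumExp a x ∂(stdGaussian E) ≤ ∫ x, logSumExp b x ∂(stdGaussian E) := by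
  set z : ℝ → I → E := fun θ i ↦ Real.cos θ • a i + Real.sin θ • b i with hz
  set w : ℝ → I → E := fun θ i ↦ -Real.sin θ • a i + Real.cos θ • b i with hw
  have hzw : ∀ θ i l, ⟪z θ i, w θ l⟫ =
      Real.sin θ * Real.cos θ * (⟪b i, b l⟫ - ⟪a i, a l⟫) := by
    intro θ i l
    have h1 := hab i l
    have h2 : ⟪b i, a l⟫ = 0 := by rw [real_inner_comm]; exact hab l i
    simp only [hz, hw, inner_add_left, inner_add_right, real_inner_smul_left,
      real_inner_smul_right, h1, h2]
    ring
  have hderiv : ∀ θ x, HasDerivAt (fun θ ↦ logSumExp (z θ) x)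
      (∑ i, softmax (z θ) i x * ⟪w θ i, x⟫) θ := by
    intro θ x
    have h1 : ∀ i, HasDerivAt (fun θ ↦ ⟪z θ i, x⟫) ⟪w θ i, x⟫ θ := by
      intro i
      simp only [hz, hw, inner_add_left, real_inner_smul_left]
      exact ((Real.hasDerivAt_cos θ).mul_const _).add ((Real.hasDerivAt_sin θ).mul_const _)
    have h2 := (HasDerivAt.fun_sum (u := Finset.univ) fun i _ ↦ (h1 i).exp).log
      (sum_exp_inner_pos (z θ) x).ne'
    convert h2 using 1
    · rfl
    · simp only [softmax, Finset.sum_div, div_mul_eq_mul_div]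
  have hbound : ∀ θ x, ‖∑ i, softmax (z θ) i x * ⟪w θ i, x⟫‖ ≤
      ∑ i, (|⟪a i, x⟫| + |⟪b i, x⟫|) := by
    intro θ x
    refine (norm_sum_le _ _).trans (Finset.sum_le_sum fun i _ ↦ ?_)
    rw [norm_mul, Real.norm_eq_abs, Real.norm_eq_abs, abs_of_nonneg (softmax_nonneg _ i x)]
    refine (mul_le_of_le_one_left (abs_nonneg _) (softmax_le_one _ i x)).trans ?_
    simp only [hw, inner_add_left, real_inner_smul_left]
    refine (abs_add_le _ _).trans ?_
    rw [abs_mul, abs_mul, abs_neg]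
    gcongr
    · exact mul_le_of_le_one_left (abs_nonneg _) (Real.abs_sin_le_one θ)
    · exact mul_le_of_le_one_left (abs_nonneg _) (Real.abs_cos_le_one θ)
  have hcont : ∀ θ, Continuous fun x ↦ ∑ i, softmax (z θ) i x * ⟪w θ i, x⟫ := by
    intro θ
    have := continuous_softmax (z θ)
    fun_prop
  have hmain : ∀ θ, HasDerivAt (fun θ ↦ ∫ x, logSumExp (z θ) x ∂(stdGaussian E))
      (∫ x, ∑ i, softmax (z θ) i x * ⟪w θ i, x⟫ ∂(stdGaussian E)) θ := fun θ ↦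
    (hasDerivAt_integral_of_dominated_loc_of_deriv_le (s := Set.univ) Filter.univ_mem
      (.of_forall fun θ ↦ (continuous_logSumExp (z θ)).aestronglyMeasurable)
      (integrable_logSumExp (z θ)) (hcont θ).aestronglyMeasurable
      (.of_forall fun x θ _ ↦ hbound θ x)
      (integrable_finsetSum _ fun i _ ↦ (integrable_inner_stdGaussian (a i)).abs.add
        (integrable_inner_stdGaussian (b i)).abs)
      (.of_forall fun x θ _ ↦ hderiv θ x)).2
  have hnonneg : ∀ θ ∈ Set.Ioo 0 (Real.pi / 2),
      0 ≤ ∫ x, ∑ i, softmax (z θ) i x * ⟪w θ i, x⟫ ∂(stdGaussian E) := by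
    intro θ hθ
    have h_int : ∀ i, Integrable (fun x ↦ softmax (z θ) i x * ⟪w θ i, x⟫) (stdGaussian E) := fun i ↦
      (integrable_inner_stdGaussian (w θ i)).bdd_mul (c := 1)
        (continuous_softmax (z θ) i).aestronglyMeasurable (.of_forall fun x ↦ by
          rw [Real.norm_eq_abs, abs_of_nonneg (softmax_nonneg _ i x)]
          exact softmax_le_one _ i x)
    rw [integral_finsetSum _ fun i _ ↦ h_int i]
    refine Finset.sum_nonneg fun i _ ↦ ?_
    rw [integral_softmax_mul_inner]
    refine integral_nonneg fun x ↦ mul_nonneg (softmax_nonneg _ i x) ?_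
    have hs : 0 ≤ Real.sin θ * Real.cos θ :=
      mul_nonneg (Real.sin_nonneg_of_mem_Icc ⟨hθ.1.le, by linarith [hθ.2, Real.pi_pos]⟩)
        (Real.cos_nonneg_of_mem_Icc ⟨by linarith [hθ.1, Real.pi_pos], hθ.2.le⟩)
    simp only [hzw, hdiag]
    rw [sub_nonneg, ← one_mul (Real.sin θ * Real.cos θ * κ), ← sum_softmax (z θ) x, Finset.sum_mul]
    refine Finset.sum_le_sum fun l _ ↦ ?_
    exact mul_le_mul_of_nonneg_left (mul_le_mul_of_nonneg_left (hle l i) hs)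
      (softmax_nonneg _ l x)
  have hmono := monotoneOn_of_deriv_nonneg (convex_Icc 0 (Real.pi / 2))
    (f := fun θ ↦ ∫ x, logSumExp (z θ) x ∂(stdGaussian E))
    (fun θ _ ↦ (hmain θ).continuousAt.continuousWithinAt)
    (fun θ _ ↦ (hmain θ).differentiableAt.differentiableWithinAt)
    (fun θ hθ ↦ by rw [interior_Icc] at hθ; rw [(hmain θ).deriv]; exact hnonneg θ hθ)
  have hpi : 0 ≤ Real.pi / 2 := by positivity
  simpa [hz] using hmono (Set.left_mem_Icc.2 hpi) (Set.right_mem_Icc.2 hpi) hpi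

end Comparison

section Frames

open scoped RealInnerProductSpace

variable {k : ℕ} {F : Type*} [NormedAddCommGroup F] [InnerProductSpace ℝ F]

/-- The operator `ℝ^k → F` with prescribed columns. -/
noncomputable def columnsOp (G : Fin k → F) : EuclideanSpace ℝ (Fin k) →L[ℝ] F :=
  ∑ c, (EuclideanSpace.proj c : EuclideanSpace ℝ (Fin k) →L[ℝ] ℝ).smulRight (G c)

lemma columnsOp_apply (G : Fin k → F) (u : EuclideanSpace ℝ (Fin k)) :
    columnsOp G u = ∑ c, u c • G c := by
  simp [columnsOp]

lemma continuous_columnsOp : Continuous (columnsOp : (Fin k → F) → _) := by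
  unfold columnsOp
  refine continuous_finsetSum _ fun c _ ↦ ?_
  exact (ContinuousLinearMap.smulRightL ℝ (EuclideanSpace ℝ (Fin k)) F
    (EuclideanSpace.proj c)).continuous.comp (continuous_apply c)

lemma norm_columnsOp_le (G : Fin k → F) : ‖columnsOp G‖ ≤ ∑ c, ‖G c‖ := by
  refine ContinuousLinearMap.opNorm_le_bound _ (by positivity) fun u ↦ ?_
  rw [columnsOp_apply, Finset.sum_mul]
  refine (norm_sum_le _ _).trans (Finset.sum_le_sum fun c _ ↦ ?_)
  rw [norm_smul, mul_comm]
  gcongr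
  exact PiLp.norm_apply_le u c

lemma opNorm_le_of_inner_le {K : Type*} [NormedAddCommGroup K] [InnerProductSpace ℝ K]
    [Nontrivial K] [Nontrivial F] (A : K →L[ℝ] F) {B : ℝ}
    (h : ∀ u v, ‖u‖ = 1 → ‖v‖ = 1 → ⟪v, A u⟫ ≤ B) : ‖A‖ ≤ B := by
  have hB : 0 ≤ B := by
    obtain ⟨u, hu⟩ := exists_norm_eq K (zero_le_one (α := ℝ))
    obtain ⟨v, hv⟩ := exists_norm_eq F (zero_le_one (α := ℝ))
    have h1 := h u v hu hv
    have h2 := h u (-v) hu (by rwa [norm_neg])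
    rw [inner_neg_left] at h2
    linarith
  refine ContinuousLinearMap.opNorm_le_of_unit_norm hB fun u hu ↦ ?_
  by_cases h0 : A u = 0
  · simpa [h0] using hB
  · have := h u ((‖A u‖⁻¹ : ℝ) • A u) hu (norm_smul_inv_norm (𝕜 := ℝ) h0)
    rwa [real_inner_smul_left, real_inner_self_eq_norm_sq, sq, inv_mul_cancel_left₀
      (norm_ne_zero_iff.2 h0)] at this

/-- The operator norm is controlled by the values of the bilinear form on nets of the unit
spheres. -/
lemma opNorm_le_of_net {K : Type*} [NormedAddCommGroup K] [InnerProductSpace ℝ K]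
    [Nontrivial K] [Nontrivial F] (A : K →L[ℝ] F) {ε : ℝ} {U : Set K} {V : Set F}
    (hU : ∀ u, ‖u‖ = 1 → ∃ u' ∈ U, ‖u - u'‖ ≤ ε) (hU1 : ∀ u ∈ U, ‖u‖ = 1)
    (hV : ∀ v, ‖v‖ = 1 → ∃ v' ∈ V, ‖v - v'‖ ≤ ε)
    {B : ℝ} (h : ∀ u ∈ U, ∀ v ∈ V, ⟪v, A u⟫ ≤ B) :
    (1 - 2 * ε) * ‖A‖ ≤ B := by
  have : ‖A‖ ≤ B + 2 * ε * ‖A‖ := by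
    refine opNorm_le_of_inner_le A fun u v hu hv ↦ ?_
    obtain ⟨u', hu', hu2⟩ := hU u hu
    obtain ⟨v', hv', hv2⟩ := hV v hv
    have e : ⟪v, A u⟫ = ⟪v', A u'⟫ + ⟪v, A (u - u')⟫ + ⟪v - v', A u'⟫ := by
      simp only [map_sub, inner_sub_left, inner_sub_right]
      ring
    have h1 : ⟪v, A (u - u')⟫ ≤ ε * ‖A‖ := by
      refine (real_inner_le_norm _ _).trans ?_
      rw [hv, one_mul, mul_comm]
      exact (A.le_opNorm _).trans (by gcongr)
    have h2 : ⟪v - v', A u'⟫ ≤ ε * ‖A‖ := by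
      refine (real_inner_le_norm _ _).trans ?_
      have := A.le_opNorm u'
      rw [hU1 u' hu', mul_one] at this
      exact mul_le_mul hv2 this (norm_nonneg _) ((norm_nonneg _).trans hv2)
    linarith [h u' hu' v' hv']
  linarith

lemma exists_finite_net_sphere (K : Type*) [NormedAddCommGroup K] [InnerProductSpace ℝ K]
    [FiniteDimensional ℝ K] {ε : ℝ} (hε : 0 < ε) :
    ∃ U : Set K, U.Finite ∧ (∀ u ∈ U, ‖u‖ = 1) ∧ ∀ u, ‖u‖ = 1 → ∃ u' ∈ U, ‖u - u'‖ ≤ ε := by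
  have : ProperSpace K := FiniteDimensional.proper ℝ K
  obtain ⟨t, ht, htf, hc⟩ := (isCompact_sphere (0 : K) 1).finite_cover_balls hε
  refine ⟨t, htf, fun u hu ↦ by simpa using ht hu, fun u hu ↦ ?_⟩
  have := hc (by simpa using hu : u ∈ Metric.sphere (0 : K) 1)
  simp only [Set.mem_iUnion, Metric.mem_ball, dist_eq_norm, exists_prop] at this
  obtain ⟨u', h1, h2⟩ := this
  exact ⟨u', h1, h2.le⟩

variable [FiniteDimensional ℝ F] [MeasurableSpace F] [BorelSpace F]

lemma map_toLp_pi_stdGaussian :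
    (Measure.pi (fun _ : Fin k ↦ stdGaussian F)).map (WithLp.toLp 2) =
      stdGaussian (PiLp 2 fun _ : Fin k ↦ F) := by
  have : IsProbabilityMeasure
      ((Measure.pi (fun _ : Fin k ↦ stdGaussian F)).map (WithLp.toLp 2)) :=
    Measure.isProbabilityMeasure_map (by fun_prop)
  apply Measure.ext_of_charFun (E := PiLp 2 fun _ : Fin k ↦ F)
  ext t
  rw [charFun_pi, charFun_stdGaussian]
  simp_rw [charFun_stdGaussian]
  rw [← Complex.exp_sum, ← Complex.ofReal_pow, PiLp.norm_sq_eq_of_L2]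
  simp [Finset.sum_div, neg_div]

/-- A linear isometry pulls the standard Gaussian measure back along its adjoint. -/
lemma map_adjoint_stdGaussian {H X : Type*} [NormedAddCommGroup H] [InnerProductSpace ℝ H]
    [FiniteDimensional ℝ H] [MeasurableSpace H] [BorelSpace H] [NormedAddCommGroup X]
    [InnerProductSpace ℝ X] [FiniteDimensional ℝ X] [MeasurableSpace X] [BorelSpace X]
    (S : X →ₗᵢ[ℝ] H) :
    (stdGaussian H).map (ContinuousLinearMap.adjoint S.toContinuousLinearMap) = stdGaussian X :=
  map_stdGaussian_of_adjoint_isometry _ S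
    (fun x t ↦ ContinuousLinearMap.adjoint_inner_left _ _ _) S.norm_map

lemma integrable_norm_apply_stdGaussian {H X : Type*} [NormedAddCommGroup H]
    [InnerProductSpace ℝ H] [FiniteDimensional ℝ H] [MeasurableSpace H] [BorelSpace H]
    [NormedAddCommGroup X] [NormedSpace ℝ X] (T : H →L[ℝ] X) :
    Integrable (fun x ↦ ‖T x‖) (stdGaussian H) :=
  (T.integrable_comp (IsGaussian.integrable_id (μ := stdGaussian H))).norm

lemma integral_norm_columnsOp_le_of_orthogonal_isometries [Nontrivial F] (hk : 0 < k)
    {H : Type*} [NormedAddCommGroup H] [InnerProductSpace ℝ H] [FiniteDimensional ℝ H]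
    [MeasurableSpace H] [BorelSpace H] (S₁ : PiLp 2 (fun _ : Fin k ↦ F) →ₗᵢ[ℝ] H)
    (S₂ : EuclideanSpace ℝ (Fin k) →ₗᵢ[ℝ] H) (S₃ : F →ₗᵢ[ℝ] H)
    (h₁₂ : ∀ m u, ⟪S₁ m, S₂ u⟫ = 0) (h₁₃ : ∀ m v, ⟪S₁ m, S₃ v⟫ = 0)
    (h₂₃ : ∀ u v, ⟪S₂ u, S₃ v⟫ = 0) :
    ∫ G, ‖columnsOp G‖ ∂(Measure.pi (fun _ : Fin k ↦ stdGaussian F)) ≤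
      √k + √(Module.finrank ℝ F) := by
  have hK : Nontrivial (EuclideanSpace ℝ (Fin k)) := by
    have : Nonempty (Fin k) := ⟨⟨0, hk⟩⟩
    infer_instance
  set T₁ := ContinuousLinearMap.adjoint S₁.toContinuousLinearMap with hdT₁
  set T₂ := ContinuousLinearMap.adjoint S₂.toContinuousLinearMap with hdT₂
  set T₃ := ContinuousLinearMap.adjoint S₃.toContinuousLinearMap with hdT₃
  have hT₁ : (stdGaussian H).map T₁ = stdGaussian (PiLp 2 fun _ : Fin k ↦ F) :=
    map_adjoint_stdGaussian S₁
  have hT₂ : (stdGaussian H).map T₂ = stdGaussian (EuclideanSpace ℝ (Fin k)) :=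
    map_adjoint_stdGaussian S₂
  have hT₃ : (stdGaussian H).map T₃ = stdGaussian F := map_adjoint_stdGaussian S₃
  have a₁ : ∀ m x, ⟪S₁ m, x⟫ = ⟪m, T₁ x⟫ := fun m x ↦
    (ContinuousLinearMap.adjoint_inner_right S₁.toContinuousLinearMap m x).symm
  have a₂ : ∀ m x, ⟪S₂ m, x⟫ = ⟪m, T₂ x⟫ := fun m x ↦
    (ContinuousLinearMap.adjoint_inner_right S₂.toContinuousLinearMap m x).symm
  have a₃ : ∀ m x, ⟪S₃ m, x⟫ = ⟪m, T₃ x⟫ := fun m x ↦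
    (ContinuousLinearMap.adjoint_inner_right S₃.toContinuousLinearMap m x).symm
  have h₃₂ : ∀ v u, ⟪S₃ v, S₂ u⟫ = 0 := fun v u ↦ by rw [real_inner_comm, h₂₃]
  have hop : Continuous fun x : H ↦ ‖columnsOp (WithLp.ofLp (T₁ x))‖ :=
    (continuous_columnsOp.comp ((PiLp.continuous_ofLp 2 _).comp T₁.continuous)).norm
  have e₁ : ∫ G, ‖columnsOp G‖ ∂(Measure.pi (fun _ : Fin k ↦ stdGaussian F)) =
      ∫ x, ‖columnsOp (WithLp.ofLp (T₁ x))‖ ∂(stdGaussian H) := by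
    have c : Continuous fun G : PiLp 2 fun _ : Fin k ↦ F ↦ ‖columnsOp (WithLp.ofLp G)‖ :=
      (continuous_columnsOp.comp (PiLp.continuous_ofLp 2 _)).norm
    rw [← integral_map (f := fun G : PiLp 2 fun _ : Fin k ↦ F ↦ ‖columnsOp (WithLp.ofLp G)‖)
      T₁.continuous.aemeasurable c.aestronglyMeasurable, hT₁, ← map_toLp_pi_stdGaussian, integral_map (by fun_prop)
      c.aestronglyMeasurable]
  have e₂ : ∫ x, ‖T₂ x‖ ∂(stdGaussian H) ≤ √k := by
    rw [← integral_map (f := fun y ↦ ‖y‖) T₂.continuous.aemeasurable (by fun_prop), hT₂]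
    simpa using integral_norm_stdGaussian_le_sqrt (E := EuclideanSpace ℝ (Fin k))
  have e₃ : ∫ x, ‖T₃ x‖ ∂(stdGaussian H) ≤ √(Module.finrank ℝ F) := by
    rw [← integral_map (f := fun y ↦ ‖y‖) T₃.continuous.aemeasurable (by fun_prop), hT₃]
    exact integral_norm_stdGaussian_le_sqrt
  have iT₂ := integrable_norm_apply_stdGaussian T₂
  have iT₃ := integrable_norm_apply_stdGaussian T₃
  have iT₂₃ : Integrable (fun x ↦ ‖T₂ x‖ + ‖T₃ x‖) (stdGaussian H) := iT₂.add iT₃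
  have iop : Integrable (fun x : H ↦ ‖columnsOp (WithLp.ofLp (T₁ x))‖) (stdGaussian H) := by
    refine Integrable.mono' (g := fun x : H ↦ ∑ c : Fin k, ‖T₁ x‖)
      (integrable_finsetSum _ fun c _ ↦ integrable_norm_apply_stdGaussian T₁)
      hop.aestronglyMeasurable (.of_forall fun x ↦ ?_)
    rw [norm_norm]
    exact (norm_columnsOp_le _).trans (Finset.sum_le_sum fun c _ ↦ PiLp.norm_apply_le _ c)
  rw [e₁]
  set X := ∫ x, ‖columnsOp (WithLp.ofLp (T₁ x))‖ ∂(stdGaussian H) with hX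
  have net : ∀ ε : ℝ, 0 < ε → (1 - 2 * ε) * X ≤ √k + √(Module.finrank ℝ F) := by
    intro ε hε
    obtain ⟨U, hUf, hU1, hU⟩ := exists_finite_net_sphere (EuclideanSpace ℝ (Fin k)) hε
    obtain ⟨V, hVf, hV1, hV⟩ := exists_finite_net_sphere F hε
    have := hUf.fintype
    have := hVf.fintype
    obtain ⟨u₀, hu₀⟩ := exists_norm_eq (EuclideanSpace ℝ (Fin k)) (zero_le_one (α := ℝ))
    obtain ⟨v₀, hv₀⟩ := exists_norm_eq F (zero_le_one (α := ℝ))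
    obtain ⟨u₁, hu₁, -⟩ := hU u₀ hu₀
    obtain ⟨v₁, hv₁, -⟩ := hV v₀ hv₀
    have : Nonempty (U × V) := ⟨⟨⟨u₁, hu₁⟩, ⟨v₁, hv₁⟩⟩⟩
    have soft : ∀ β : ℝ, 0 < β → (1 - 2 * ε) * X ≤
        √k + √(Module.finrank ℝ F) + Real.log (Fintype.card (U × V)) * β⁻¹ := by
      intro β hβ
      set a : U × V → H := fun p ↦ β • S₁ (WithLp.toLp 2 (fun c ↦ p.1.1 c • p.2.1)) with hdefa
      set b : U × V → H := fun p ↦ β • (S₂ p.1.1 + S₃ p.2.1) with hdefb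
      have ha : ∀ p q, ⟪a p, a q⟫ = β ^ 2 * (⟪p.1.1, q.1.1⟫ * ⟪p.2.1, q.2.1⟫) := by
        intro p q
        simp only [a, real_inner_smul_left, real_inner_smul_right, S₁.inner_map_map,
          PiLp.inner_apply, Finset.sum_mul, RCLike.inner_apply, conj_trivial]
        rw [sq, mul_assoc]
        congr 2
        refine Finset.sum_congr rfl fun c _ ↦ ?_
        ring
      have hb : ∀ p q, ⟪b p, b q⟫ = β ^ 2 * (⟪p.1.1, q.1.1⟫ + ⟪p.2.1, q.2.1⟫) := by
        intro p q
        simp only [b, real_inner_smul_left, real_inner_smul_right, inner_add_left,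
          inner_add_right, S₂.inner_map_map, S₃.inner_map_map, h₂₃, h₃₂]
        ring
      have hax : ∀ p x, ⟪a p, x⟫ = β * ⟪p.2.1, columnsOp (WithLp.ofLp (T₁ x)) p.1.1⟫ := by
        intro p x
        simp only [a, real_inner_smul_left, a₁, PiLp.inner_apply, columnsOp_apply, inner_sum,
          real_inner_smul_right]
      have hbx : ∀ p x, ⟪b p, x⟫ = β * (⟪p.1.1, T₂ x⟫ + ⟪p.2.1, T₃ x⟫) := by
        intro p x
        simp only [b, real_inner_smul_left, inner_add_left, a₂, a₃]
      have comp := integral_logSumExp_le_of_inner_le (a := a) (b := b) (κ := β ^ 2)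
        (fun p q ↦ by
          simp [a, b, real_inner_smul_left, real_inner_smul_right, inner_add_right, h₁₂, h₁₃])
        (fun p ↦ by
          rw [ha, hb]
          simp only [real_inner_self_eq_norm_sq, hU1 _ p.1.2, hV1 _ p.2.2]
          ring)
        (fun p q ↦ by
          rw [ha, hb]
          have h1 : ⟪p.1.1, q.1.1⟫ ≤ 1 := by
            have := real_inner_le_norm p.1.1 q.1.1
            rwa [hU1 _ p.1.2, hU1 _ q.1.2, one_mul] at this
          have h2 : ⟪p.2.1, q.2.1⟫ ≤ 1 := by
            have := real_inner_le_norm p.2.1 q.2.1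
            rwa [hV1 _ p.2.2, hV1 _ q.2.2, one_mul] at this
          nlinarith [mul_nonneg (sq_nonneg β) (mul_nonneg (sub_nonneg.2 h1) (sub_nonneg.2 h2))])
      have lower : ∀ x, β * ((1 - 2 * ε) * ‖columnsOp (WithLp.ofLp (T₁ x))‖) ≤
          logSumExp a x := by
        intro x
        have : ∀ p : U × V, ⟪p.2.1, columnsOp (WithLp.ofLp (T₁ x)) p.1.1⟫ ≤
            β⁻¹ * logSumExp a x := by
          intro p
          have := inner_le_logSumExp a p x
          rw [hax] at this
          rw [inv_mul_eq_div, le_div_iff₀ hβ]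
          linarith
        have key := opNorm_le_of_net (columnsOp (WithLp.ofLp (T₁ x))) hU hU1 hV
          (B := β⁻¹ * logSumExp a x) (fun u hu v hv ↦ this (⟨u, hu⟩, ⟨v, hv⟩))
        rw [inv_mul_eq_div, le_div_iff₀ hβ] at key
        linarith
      have upper : ∀ x, logSumExp b x ≤
          β * (‖T₂ x‖ + ‖T₃ x‖) + Real.log (Fintype.card (U × V)) := by
        intro x
        refine logSumExp_le b x fun p ↦ ?_
        rw [hbx]
        gcongr
        · refine (real_inner_le_norm _ _).trans ?_
          rw [hU1 _ p.1.2, one_mul]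
        · refine (real_inner_le_norm _ _).trans ?_
          rw [hV1 _ p.2.2, one_mul]
      have l := integral_mono ((iop.const_mul (1 - 2 * ε)).const_mul β) (integrable_logSumExp a)
        lower
      have r := integral_mono (g := fun x ↦ β * (‖T₂ x‖ + ‖T₃ x‖) +
        Real.log (Fintype.card (U × V))) (integrable_logSumExp b)
        ((iT₂₃.const_mul β).add (integrable_const _)) upper
      rw [integral_add (iT₂₃.const_mul β) (integrable_const _),
        integral_const_mul, integral_add iT₂ iT₃] at r
      simp only [integral_const_mul, integral_const, probReal_univ, one_smul] at l r
      have : β * ((1 - 2 * ε) * X) ≤ β * (√k + √(Module.finrank ℝ F)) +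
          Real.log (Fintype.card (U × V)) := by
        refine l.trans (comp.trans (r.trans ?_))
        gcongr
      rw [← mul_le_mul_iff_right₀ hβ]
      refine this.trans (le_of_eq ?_)
      field_simp
    have lim : Filter.Tendsto (fun β : ℝ ↦ √k + √(Module.finrank ℝ F) +
        Real.log (Fintype.card (U × V)) * β⁻¹) Filter.atTop
        (nhds (√k + √(Module.finrank ℝ F) + Real.log (Fintype.card (U × V)) * 0)) :=
      tendsto_const_nhds.add (tendsto_const_nhds.mul tendsto_inv_atTop_zero)
    rw [mul_zero, add_zero] at lim
    exact ge_of_tendsto lim (Filter.eventually_atTop.2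
      ⟨1, fun β hβ ↦ soft β (by linarith)⟩)
  have lim : Filter.Tendsto (fun n : ℕ ↦ (1 - 2 * (1 / ((n : ℝ) + 1))) * X) Filter.atTop
      (nhds ((1 - 2 * 0) * X)) :=
    (tendsto_const_nhds.sub (tendsto_const_nhds.mul
      tendsto_one_div_add_atTop_nhds_zero_nat)).mul tendsto_const_nhds
  rw [mul_zero, sub_zero, one_mul] at lim
  exact le_of_tendsto' lim fun n ↦ net _ (by positivity)

/-- **Chevet's inequality** for a standard Gaussian matrix. -/
lemma integral_norm_columnsOp_le [Nontrivial F] (hk : 0 < k) :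
    ∫ G, ‖columnsOp G‖ ∂(Measure.pi (fun _ : Fin k ↦ stdGaussian F)) ≤
      √k + √(Module.finrank ℝ F) :=
  integral_norm_columnsOp_le_of_orthogonal_isometries hk
    (H := WithLp 2 (PiLp 2 (fun _ : Fin k ↦ F) × WithLp 2 (EuclideanSpace ℝ (Fin k) × F)))
    ⟨⟨⟨fun m ↦ WithLp.toLp 2 (m, 0), fun x y ↦ by
        simp [← WithLp.toLp_add]⟩, fun c x ↦ by simp [← WithLp.toLp_smul]⟩, fun m ↦ by simp⟩
    ⟨⟨⟨fun u ↦ WithLp.toLp 2 (0, WithLp.toLp 2 (u, 0)), fun x y ↦ by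
        simp [← WithLp.toLp_add]⟩, fun c x ↦ by simp [← WithLp.toLp_smul]⟩, fun u ↦ by simp⟩
    ⟨⟨⟨fun v ↦ WithLp.toLp 2 (0, WithLp.toLp 2 (0, v)), fun x y ↦ by
        simp [← WithLp.toLp_add]⟩, fun c x ↦ by simp [← WithLp.toLp_smul]⟩, fun v ↦ by simp⟩
    (fun m u ↦ by simp) (fun m v ↦ by simp) (fun u v ↦ by simp)

end Frames

section Trace

open scoped RealInnerProductSpace

variable {E : Type*} [NormedAddCommGroup E] [InnerProductSpace ℝ E] [FiniteDimensional ℝ E]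
  [MeasurableSpace E] [BorelSpace E]

lemma integral_norm_orthogonalProjection_stdGaussian (V : Submodule ℝ E)
    (hV : 0 < Module.finrank ℝ V) :
    ∫ g, ‖V.orthogonalProjectionOnto g‖ ∂(stdGaussian E) = chiMean (Module.finrank ℝ V) := by
  have hT : (stdGaussian E).map V.orthogonalProjectionOnto = stdGaussian V :=
    map_stdGaussian_of_adjoint_isometry _ (fun t ↦ (t : E))
      (fun x t ↦ Submodule.inner_orthogonalProjectionOnto_eq_of_mem_right t x) (fun t ↦ rfl)
  rw [← integral_norm_stdGaussian hV, ← hT, integral_map (by fun_prop) (by fun_prop)]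

lemma exists_unit_inner_eq_norm_orthogonalProjection (V : Submodule ℝ E)
    (hV : 0 < Module.finrank ℝ V) (g : E) :
    ∃ v ∈ V, ‖v‖ = 1 ∧ ⟪v, g⟫ = ‖V.orthogonalProjectionOnto g‖ := by
  have : Nontrivial V := Module.finrank_pos_iff.1 hV
  have key : ∀ v : V, ⟪(v : E), g⟫ = ⟪v, V.orthogonalProjectionOnto g⟫ := fun v ↦
    (Submodule.inner_orthogonalProjectionOnto_eq_of_mem_left v g).symm
  by_cases h : V.orthogonalProjectionOnto g = 0
  · obtain ⟨v, hv⟩ := exists_norm_eq V (zero_le_one (α := ℝ))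
    exact ⟨v, v.2, hv, by rw [key, h, inner_zero_right, norm_zero]⟩
  · refine ⟨(((‖V.orthogonalProjectionOnto g‖⁻¹ : ℝ) • V.orthogonalProjectionOnto g : V) : E),
      Subtype.coe_prop _, norm_smul_inv_norm (𝕜 := ℝ) (x := V.orthogonalProjectionOnto g) h, ?_⟩
    rw [key, real_inner_smul_left, real_inner_self_eq_norm_sq, sq,
      inv_mul_cancel_left₀ (norm_ne_zero_iff.2 h)]

lemma orthonormal_finCons {k : ℕ} {q : Fin k → E} (hq : Orthonormal ℝ q) {v : E}
    (hv : ‖v‖ = 1) (hvq : v ∈ (Submodule.span ℝ (Set.range q))ᗮ) :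
    Orthonormal ℝ (Fin.cons v q : Fin (k + 1) → E) := by
  have h0 : ∀ c, ⟪q c, v⟫ = 0 := fun c ↦
    (Submodule.mem_orthogonal _ _).1 hvq _ (Submodule.subset_span ⟨c, rfl⟩)
  refine ⟨fun c ↦ ?_, fun c d hcd ↦ ?_⟩
  · refine Fin.cases ?_ (fun c ↦ ?_) c
    · simpa using hv
    · simpa using hq.1 c
  · revert hcd
    refine Fin.cases ?_ (fun c ↦ ?_) c <;> refine Fin.cases ?_ (fun d ↦ ?_) d <;> intro hcd
    · exact absurd rfl hcd
    · simpa [real_inner_comm] using h0 d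
    · simpa using h0 c
    · simpa using hq.2 (fun h ↦ hcd (by rw [h]))

/-- A function dominating the pairing of a Gaussian frame with all orthonormal frames has a large
mean. -/
lemma sum_chiMean_le_integral {k : ℕ} (hk : k ≤ Module.finrank ℝ E) {K : (Fin k → E) → ℝ}
    (hK : Integrable K (Measure.pi fun _ ↦ stdGaussian E))
    (h : ∀ᵐ g ∂(Measure.pi fun _ : Fin k ↦ stdGaussian E), ∀ q : Fin k → E,
      Orthonormal ℝ q → ∑ c, ⟪q c, g c⟫ ≤ K g) :
    ∑ c ∈ Finset.range k, chiMean (Module.finrank ℝ E - c) ≤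
      ∫ g, K g ∂(Measure.pi fun _ ↦ stdGaussian E) := by
  induction k with
  | zero =>
    refine integral_nonneg_of_ae ?_
    filter_upwards [h] with g hg
    simpa using hg Fin.elim0 ⟨fun c ↦ c.elim0, fun c ↦ c.elim0⟩
  | succ k ih =>
    set γ := Measure.pi fun _ : Fin k ↦ stdGaussian E with hγ
    have mp : MeasurePreserving (fun z : (Fin k → E) × E ↦ (Fin.cons z.2 z.1 : Fin (k + 1) → E))
        (γ.prod (stdGaussian E)) (Measure.pi fun _ ↦ stdGaussian E) := by
      have := (measurePreserving_piFinSuccAbove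
        (fun _ : Fin (k + 1) ↦ stdGaussian E) 0).symm.comp
          (Measure.measurePreserving_swap (μ := γ) (ν := stdGaussian E))
      convert this using 1
      ext z c
      refine Fin.cases ?_ (fun c ↦ ?_) c <;> simp [MeasurableEquiv.piFinSuccAbove_symm_apply]
    have hK' : Integrable (fun z : (Fin k → E) × E ↦ K (Fin.cons z.2 z.1))
        (γ.prod (stdGaussian E)) := mp.integrable_comp_of_integrable hK
    have iK := hK'.integral_prod_left
    have eK : ∫ g, K g ∂(Measure.pi fun _ : Fin (k + 1) ↦ stdGaussian E) =
        ∫ G, ∫ g, K (Fin.cons g G : Fin (k + 1) → E) ∂(stdGaussian E) ∂γ := by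
      rw [← mp.map_eq, integral_map mp.measurable.aemeasurable (by rw [mp.map_eq]; exact hK.1),
        integral_prod _ hK']
    have h' := Measure.ae_ae_of_ae_prod (mp.quasiMeasurePreserving.ae h)
    have key := ih (by omega) (K := fun G ↦
        ∫ g, K (Fin.cons g G : Fin (k + 1) → E) ∂(stdGaussian E) -
          chiMean (Module.finrank ℝ E - k))
      (iK.sub (integrable_const _)) (by
        filter_upwards [h', hK'.prod_right_ae] with G hG iG q hq
        set V := (Submodule.span ℝ (Set.range q))ᗮ with hV
        have hdim : Module.finrank ℝ V = Module.finrank ℝ E - k := by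
          have := Submodule.finrank_add_finrank_orthogonal (Submodule.span ℝ (Set.range q))
          rw [finrank_span_eq_card hq.linearIndependent, Fintype.card_fin] at this
          rw [hV]
          omega
        have hpos : 0 < Module.finrank ℝ V := by omega
        have iP : Integrable (fun g ↦ ‖V.orthogonalProjectionOnto g‖) (stdGaussian E) :=
          integrable_norm_apply_stdGaussian V.orthogonalProjectionOnto
        have : ∫ g, (‖V.orthogonalProjectionOnto g‖ + ∑ c, ⟪q c, G c⟫) ∂(stdGaussian E) ≤
            ∫ g, K (Fin.cons g G : Fin (k + 1) → E) ∂(stdGaussian E) := by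
          refine integral_mono_ae (iP.add (integrable_const _)) iG ?_
          filter_upwards [hG] with g hg
          obtain ⟨v, hvV, hv1, hvg⟩ :=
            exists_unit_inner_eq_norm_orthogonalProjection V hpos g
          have := hg _ (orthonormal_finCons hq hv1 hvV)
          simpa [Fin.sum_univ_succ, hvg] using this
        rw [integral_add iP (integrable_const _),
          integral_norm_orthogonalProjection_stdGaussian V hpos, hdim] at this
        simp only [integral_const, probReal_univ, one_smul] at this
        linarith)
    rw [integral_sub iK (integrable_const _)] at key
    simp only [integral_const, probReal_univ, one_smul] at key
    rw [eK, Finset.sum_range_succ]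
    linarith

end Trace

section Averaging

/-- The `n × k` matrix formed by the first `k` columns of the identity. -/
def firstColumns {n k : ℕ} (hkn : k ≤ n) : Matrix (Fin n) (Fin k) ℝ :=
  (1 : Matrix (Fin n) (Fin n) ℝ).submatrix id (Fin.castLE hkn)

lemma seminorm_sum_le {ι V : Type*} [AddCommGroup V] [Module ℝ V] (h : Seminorm ℝ V)
    (s : Finset ι) (f : ι → V) : h (∑ i ∈ s, f i) ≤ ∑ i ∈ s, h (f i) :=
  Finset.le_sum_of_subadditive h (map_zero h).le (map_add_le_add h) s f

lemma sum_signs_mul {m : ℕ} {i l : Fin m} (hil : i ≠ l) :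
    ∑ s : Fin m → ℤˣ, ((s i : ℤ) : ℝ) * ((s l : ℤ) : ℝ) = 0 := by
  have h := Equiv.sum_comp (Equiv.mulLeft (Pi.mulSingle i (-1) : Fin m → ℤˣ))
    (fun s : Fin m → ℤˣ ↦ ((s i : ℤ) : ℝ) * ((s l : ℤ) : ℝ))
  simp only [Equiv.coe_mulLeft, Pi.mul_apply, Pi.mulSingle_eq_same,
    Pi.mulSingle_eq_of_ne hil.symm, one_mul, Units.val_neg, neg_mul, Int.cast_neg,
    Finset.sum_neg_distrib] at h
  linarith

lemma intCast_units_mul_self {m : ℕ} (s : Fin m → ℤˣ) (i : Fin m) :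
    ((s i : ℤ) : ℝ) * ((s i : ℤ) : ℝ) = 1 := by
  rcases Int.units_eq_one_or (s i) with h | h <;> simp [h]

lemma transpose_diagonal_sign_mul {m : ℕ} (s : Fin m → ℤˣ) :
    (diagonal fun i ↦ ((s i : ℤ) : ℝ))ᵀ * diagonal (fun i ↦ ((s i : ℤ) : ℝ)) = 1 := by
  rw [diagonal_transpose, diagonal_mul_diagonal]
  simp_rw [intCast_units_mul_self]
  exact diagonal_one

lemma transpose_perm_submatrix_mul {m : ℕ} (σ : Equiv.Perm (Fin m)) :
    ((1 : Matrix (Fin m) (Fin m) ℝ).submatrix σ id)ᵀ *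
      (1 : Matrix (Fin m) (Fin m) ℝ).submatrix σ id = 1 := by
  rw [transpose_submatrix, transpose_one, submatrix_mul_equiv, one_mul, submatrix_id_id]

variable {n k : ℕ} (hkn : k ≤ n) (h : Seminorm ℝ (Matrix (Fin n) (Fin k) ℝ))
  (hL : ∀ W : Matrix (Fin n) (Fin n) ℝ, Wᵀ * W = 1 → ∀ M, h (W * M) = h M)
  (hR : ∀ V : Matrix (Fin k) (Fin k) ℝ, Vᵀ * V = 1 → ∀ M, h (M * V) = h M)

include hL hR

lemma seminorm_diagonalPart_le (M : Matrix (Fin n) (Fin k) ℝ) :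
    h (firstColumns hkn * diagonal fun c ↦ M (Fin.castLE hkn c) c) ≤ h M := by
  set N : ℝ := (Fintype.card (Fin n → ℤˣ) : ℝ) with hN
  have hN0 : 0 < N := by simp only [hN, Nat.cast_pos]; exact Fintype.card_pos
  have key : N • (firstColumns hkn * diagonal fun c ↦ M (Fin.castLE hkn c) c) =
      ∑ s : Fin n → ℤˣ, diagonal (fun i ↦ ((s i : ℤ) : ℝ)) *
        (M * diagonal fun c ↦ ((s (Fin.castLE hkn c) : ℤ) : ℝ)) := by
    ext i c
    simp only [Matrix.sum_apply, diagonal_mul, mul_diagonal, Matrix.smul_apply, firstColumns,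
      submatrix_apply, id, one_apply, smul_eq_mul]
    have e : ∀ s : Fin n → ℤˣ, ((s i : ℤ) : ℝ) * (M i c * ((s (Fin.castLE hkn c) : ℤ) : ℝ)) =
        M i c * (((s i : ℤ) : ℝ) * ((s (Fin.castLE hkn c) : ℤ) : ℝ)) := fun s ↦ by ring
    simp_rw [e]
    rw [← Finset.mul_sum]
    by_cases hic : i = Fin.castLE hkn c
    · subst hic
      simp_rw [intCast_units_mul_self]
      simp [hN, mul_comm]
    · rw [sum_signs_mul hic]
      simp [hic]
  have := seminorm_sum_le h Finset.univ fun s : Fin n → ℤˣ ↦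
    diagonal (fun i ↦ ((s i : ℤ) : ℝ)) *
      (M * diagonal fun c ↦ ((s (Fin.castLE hkn c) : ℤ) : ℝ))
  rw [← key, map_smul_eq_mul, Real.norm_of_nonneg hN0.le] at this
  simp_rw [hL _ (transpose_diagonal_sign_mul _)] at this
  have e : ∀ s : Fin n → ℤˣ, h (M * diagonal fun c ↦ ((s (Fin.castLE hkn c) : ℤ) : ℝ)) = h M :=
    fun s ↦ hR _ (transpose_diagonal_sign_mul fun c ↦ s (Fin.castLE hkn c)) M
  simp_rw [e] at this
  rw [Finset.sum_const, Finset.card_univ, nsmul_eq_mul] at this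
  exact le_of_mul_le_mul_left this hN0

lemma seminorm_submatrix_perm (π : Equiv.Perm (Fin n)) (σ : Equiv.Perm (Fin k))
    (M : Matrix (Fin n) (Fin k) ℝ) : h (M.submatrix π σ) = h M := by
  have e : M.submatrix π σ = (1 : Matrix (Fin n) (Fin n) ℝ).submatrix π id *
      (M * (1 : Matrix (Fin k) (Fin k) ℝ).submatrix σ.symm id) := by
    ext i c
    simp [mul_apply, one_apply, Equiv.symm_apply_eq]
  rw [e, hL _ (transpose_perm_submatrix_mul _), hR _ (transpose_perm_submatrix_mul _)]

lemma abs_sum_mul_seminorm_firstColumns_le [NeZero k] (d : Fin k → ℝ) :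
    |∑ c, d c| * h (firstColumns hkn) ≤ k * h (firstColumns hkn * diagonal d) := by
  let π : Fin k → Equiv.Perm (Fin n) := fun t ↦
    (Equiv.addRight t).viaFintypeEmbedding (Fin.castLEEmb hkn)
  have hπ : ∀ t c, π t (Fin.castLE hkn c) = Fin.castLE hkn (c + t) := fun t c ↦
    Equiv.Perm.viaFintypeEmbedding_apply_image (Equiv.addRight t) (Fin.castLEEmb hkn) c
  have key : (∑ c, d c) • firstColumns hkn =
      ∑ t, (firstColumns hkn * diagonal d).submatrix (π t) (Equiv.addRight t) := by
    ext i c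
    simp only [Matrix.sum_apply, mul_diagonal, Matrix.smul_apply, firstColumns,
      submatrix_apply, id, one_apply, smul_eq_mul, Equiv.coe_addRight, ← hπ,
      EmbeddingLike.apply_eq_iff_eq]
    rw [← Finset.mul_sum, mul_comm]
    congr 1
    exact (Equiv.sum_comp (Equiv.addLeft c) d).symm
  have := seminorm_sum_le h Finset.univ fun t ↦
    (firstColumns hkn * diagonal d).submatrix (π t) (Equiv.addRight t)
  rw [← key, map_smul_eq_mul, Real.norm_eq_abs] at this
  simp_rw [seminorm_submatrix_perm h hL hR] at this
  simpa using this

lemma trace_mul_seminorm_firstColumns_le [NeZero k] (M : Matrix (Fin n) (Fin k) ℝ) :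
    (∑ c, M (Fin.castLE hkn c) c) * h (firstColumns hkn) ≤ k * h M :=
  (mul_le_mul_of_nonneg_right (le_abs_self _) (apply_nonneg h _)).trans
    ((abs_sum_mul_seminorm_firstColumns_le hkn h hL hR _).trans
      (mul_le_mul_of_nonneg_left (seminorm_diagonalPart_le hkn h hL hR M) k.cast_nonneg))

omit hL hR in
lemma exists_orthogonal_mul_firstColumns {Q : Matrix (Fin n) (Fin k) ℝ} (hQ : Qᵀ * Q = 1) :
    ∃ W : Matrix (Fin n) (Fin n) ℝ, Wᵀ * W = 1 ∧ W * firstColumns hkn = Q := by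
  let v : Fin n → EuclideanSpace ℝ (Fin n) := fun c ↦
    if hc : (c : ℕ) < k then WithLp.toLp 2 (fun i ↦ Q i ⟨c, hc⟩) else 0
  have hv : Orthonormal ℝ (Set.domRestrict {c : Fin n | (c : ℕ) < k} v) := by
    rw [orthonormal_iff_ite]
    rintro ⟨c, hc⟩ ⟨d, hd⟩
    have hc' : (c : ℕ) < k := hc
    have hd' : (d : ℕ) < k := hd
    have := congrFun (congrFun hQ ⟨c, hc'⟩) ⟨d, hd'⟩
    rw [mul_apply, one_apply] at this
    change inner ℝ (v c) (v d) = _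
    simpa [v, hc', hd', PiLp.inner_apply, Fin.ext_iff, mul_comm] using this
  obtain ⟨b, hb⟩ := hv.exists_orthonormalBasis_extension_of_card_eq (by simp)
  refine ⟨of fun i c ↦ b c i, ?_, ?_⟩
  · ext c d
    have := orthonormal_iff_ite.1 b.orthonormal c d
    rw [mul_apply, one_apply, ← this, PiLp.inner_apply]
    simp [mul_comm]
  · ext i c
    simp [mul_apply, firstColumns, one_apply, hb (Fin.castLE hkn c) c.2, v]

/-- An orthogonally invariant seminorm dominates the pairing with any orthonormal frame. -/
lemma frame_pairing_mul_seminorm_firstColumns_le [NeZero k] {Q : Matrix (Fin n) (Fin k) ℝ}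
    (hQ : Qᵀ * Q = 1) (M : Matrix (Fin n) (Fin k) ℝ) :
    (∑ c, ∑ i, Q i c * M i c) * h (firstColumns hkn) ≤ k * h M := by
  obtain ⟨W, hW, rfl⟩ := exists_orthogonal_mul_firstColumns hkn hQ
  have := trace_mul_seminorm_firstColumns_le hkn h hL hR (Wᵀ * M)
  rw [hL Wᵀ (by rw [transpose_transpose]; exact mul_eq_one_comm.1 hW)] at this
  convert this using 4
  simp [mul_apply, firstColumns, one_apply]

end Averaging

section OrthogonalGroup

instance matrixSecondCountableTopology (n k : ℕ) :
    SecondCountableTopology (Matrix (Fin n) (Fin k) ℝ) :=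
  inferInstanceAs (SecondCountableTopology (Fin n → Fin k → ℝ))

instance matrixBorelSpace (n k : ℕ) : BorelSpace (Matrix (Fin n) (Fin k) ℝ) :=
  inferInstanceAs (BorelSpace (Fin n → Fin k → ℝ))

instance orthogonalGroupBorelSpace (n : ℕ) : BorelSpace (orthogonalGroup (Fin n) ℝ) :=
  Subtype.borelSpace _

instance orthogonalGroupCompactSpace (n : ℕ) : CompactSpace (orthogonalGroup (Fin n) ℝ) := by
  refine isCompact_iff_compactSpace.1 (IsCompact.of_isClosed_subset
    (isCompact_univ_pi (X := fun _ : Fin n ↦ Fin n → ℝ)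
      fun _ ↦ isCompact_univ_pi fun _ ↦ isCompact_closedBall (0 : ℝ) 1)
    (isClosed_unitary (R := Matrix (Fin n) (Fin n) ℝ)) fun U hU i _ l _ ↦ ?_)
  simpa using entry_norm_bound_of_unitary hU i l

/-- The Haar probability measure on the orthogonal group. -/
noncomputable def orthogonalHaar (n : ℕ) : Measure (orthogonalGroup (Fin n) ℝ) :=
  Measure.haarMeasure ⊤

instance (n : ℕ) : IsProbabilityMeasure (orthogonalHaar n) :=
  ⟨by simpa [orthogonalHaar] using Measure.haarMeasure_self (K₀ :=
    (⊤ : TopologicalSpace.PositiveCompacts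
    (orthogonalGroup (Fin n) ℝ)))⟩

instance (n : ℕ) : (orthogonalHaar n).IsMulLeftInvariant :=
  inferInstanceAs (Measure.haarMeasure _).IsMulLeftInvariant

variable {n k : ℕ}

lemma continuous_inv_mul_matrix :
    Continuous fun z : Matrix (Fin n) (Fin k) ℝ × orthogonalGroup (Fin n) ℝ ↦
      ((z.2⁻¹ : orthogonalGroup (Fin n) ℝ) : Matrix (Fin n) (Fin n) ℝ) * z.1 :=
  (continuous_subtype_val.comp continuous_snd.inv).matrix_mul continuous_fst

lemma integrable_haar_seminorm {f : Seminorm ℝ (Matrix (Fin n) (Fin k) ℝ)} (hf : Continuous f)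
    (M : Matrix (Fin n) (Fin k) ℝ) :
    Integrable (fun O : orthogonalGroup (Fin n) ℝ ↦
      f (((O⁻¹ : orthogonalGroup (Fin n) ℝ) : Matrix (Fin n) (Fin n) ℝ) * M))
      (orthogonalHaar n) := by
  have c : Continuous fun O : orthogonalGroup (Fin n) ℝ ↦
      f (((O⁻¹ : orthogonalGroup (Fin n) ℝ) : Matrix (Fin n) (Fin n) ℝ) * M) :=
    hf.comp (continuous_inv_mul_matrix.comp (Continuous.prodMk_right M))
  have : IsFiniteMeasureOnCompacts (orthogonalHaar n) := inferInstance
  exact c.integrable_of_hasCompactSupport (HasCompactSupport.of_compactSpace _)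

/-- The average of a continuous seminorm on matrices over the left action of the orthogonal
group. -/
noncomputable def averagedSeminorm (f : Seminorm ℝ (Matrix (Fin n) (Fin k) ℝ))
    (hf : Continuous f) : Seminorm ℝ (Matrix (Fin n) (Fin k) ℝ) :=
  Seminorm.of (fun M ↦ ∫ O : orthogonalGroup (Fin n) ℝ,
      f (((O⁻¹ : orthogonalGroup (Fin n) ℝ) : Matrix (Fin n) (Fin n) ℝ) * M) ∂(orthogonalHaar n))
    (fun A B ↦ by
      rw [← integral_add (integrable_haar_seminorm hf A) (integrable_haar_seminorm hf B)]
      refine integral_mono (integrable_haar_seminorm hf _)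
        ((integrable_haar_seminorm hf A).add (integrable_haar_seminorm hf B)) fun O ↦ ?_
      simp only [Matrix.mul_add]
      exact map_add_le_add f _ _)
    (fun c A ↦ by
      simp only [Matrix.mul_smul, map_smul_eq_mul]
      exact integral_const_mul _ _)

variable (f : Seminorm ℝ (Matrix (Fin n) (Fin k) ℝ)) (hf : Continuous f)

lemma averagedSeminorm_apply (M : Matrix (Fin n) (Fin k) ℝ) :
    averagedSeminorm f hf M = ∫ O : orthogonalGroup (Fin n) ℝ,
      f (((O⁻¹ : orthogonalGroup (Fin n) ℝ) : Matrix (Fin n) (Fin n) ℝ) * M)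
        ∂(orthogonalHaar n) := rfl

lemma averagedSeminorm_mul_left {W : Matrix (Fin n) (Fin n) ℝ} (hW : Wᵀ * W = 1)
    (M : Matrix (Fin n) (Fin k) ℝ) : averagedSeminorm f hf (W * M) = averagedSeminorm f hf M := by
  let w : orthogonalGroup (Fin n) ℝ := ⟨W, (mem_orthogonalGroup_iff' _ _).2 hW⟩
  rw [averagedSeminorm_apply, averagedSeminorm_apply,
    ← integral_mul_left_eq_self (μ := orthogonalHaar n) _ w]
  congr 1
  ext O
  have hw : ((w⁻¹ : orthogonalGroup (Fin n) ℝ) : Matrix (Fin n) (Fin n) ℝ) * W = 1 :=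
    congrArg Subtype.val (inv_mul_cancel w)
  rw [_root_.mul_inv_rev, Submonoid.coe_mul, Matrix.mul_assoc, ← Matrix.mul_assoc _ W, hw,
    Matrix.one_mul]

lemma averagedSeminorm_mul_right
    (hR : ∀ V : Matrix (Fin k) (Fin k) ℝ, Vᵀ * V = 1 → ∀ M, f (M * V) = f M)
    {V : Matrix (Fin k) (Fin k) ℝ} (hV : Vᵀ * V = 1)
    (M : Matrix (Fin n) (Fin k) ℝ) : averagedSeminorm f hf (M * V) = averagedSeminorm f hf M := by
  simp_rw [averagedSeminorm_apply, ← Matrix.mul_assoc, hR V hV]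

variable (μ : Measure (Matrix (Fin n) (Fin k) ℝ)) [IsProbabilityMeasure μ]
  (hμ : ∀ U : Matrix (Fin n) (Fin n) ℝ, Uᵀ * U = 1 → μ.map (fun Q ↦ U * Q) = μ)

include hμ

lemma measurePreserving_mul_left_of_invariant {U : Matrix (Fin n) (Fin n) ℝ} (hU : Uᵀ * U = 1) :
    MeasurePreserving (fun M ↦ U * M) μ μ :=
  ⟨(continuous_const.matrix_mul continuous_id).measurable, hμ U hU⟩

include hf in
lemma integral_mul_left_of_invariant {U : Matrix (Fin n) (Fin n) ℝ} (hU : Uᵀ * U = 1) :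
    ∫ M, f (U * M) ∂μ = ∫ M, f M ∂μ := by
  have mp := measurePreserving_mul_left_of_invariant μ hμ hU
  conv_rhs => rw [← mp.map_eq]
  exact (integral_map mp.measurable.aemeasurable hf.aestronglyMeasurable).symm

include hf in
lemma integrable_prod_haar (hfμ : Integrable f μ) :
    Integrable (fun z : Matrix (Fin n) (Fin k) ℝ × orthogonalGroup (Fin n) ℝ ↦
      f (((z.2⁻¹ : orthogonalGroup (Fin n) ℝ) : Matrix (Fin n) (Fin n) ℝ) * z.1))
      (μ.prod (orthogonalHaar n)) := by
  have hO : ∀ O : orthogonalGroup (Fin n) ℝ,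
      (O : Matrix (Fin n) (Fin n) ℝ)ᵀ * (O : Matrix (Fin n) (Fin n) ℝ) = 1 :=
    fun O ↦ (mem_orthogonalGroup_iff' _ _).1 O.2
  have c := hf.comp (continuous_inv_mul_matrix (n := n) (k := k))
  refine (integrable_prod_iff' c.aestronglyMeasurable).2 ⟨.of_forall fun O ↦
    (measurePreserving_mul_left_of_invariant μ hμ (hO O⁻¹)).integrable_comp_of_integrable hfμ, ?_⟩
  simp only [Function.comp_apply, Real.norm_of_nonneg (apply_nonneg f _)]
  simp_rw [integral_mul_left_of_invariant f hf μ hμ (hO _⁻¹)]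
  exact integrable_const _

lemma integrable_averagedSeminorm (hfμ : Integrable f μ) :
    Integrable (averagedSeminorm f hf) μ :=
  (integrable_prod_haar f hf μ hμ hfμ).integral_prod_left

lemma integral_averagedSeminorm (hfμ : Integrable f μ) :
    ∫ M, averagedSeminorm f hf M ∂μ = ∫ M, f M ∂μ := by
  simp_rw [averagedSeminorm_apply]
  rw [← integral_prod _ (integrable_prod_haar f hf μ hμ hfμ),
    integral_prod_symm _ (integrable_prod_haar f hf μ hμ hfμ)]
  have hO : ∀ O : orthogonalGroup (Fin n) ℝ,
      (O : Matrix (Fin n) (Fin n) ℝ)ᵀ * (O : Matrix (Fin n) (Fin n) ℝ) = 1 :=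
    fun O ↦ (mem_orthogonalGroup_iff' _ _).1 O.2
  simp_rw [integral_mul_left_of_invariant f hf μ hμ (hO _⁻¹)]
  simp

end OrthogonalGroup

section GaussianMatrix

open scoped RealInnerProductSpace

variable {n k : ℕ}

/-- The matrix with prescribed columns. -/
def frameMatrix (g : Fin k → EuclideanSpace ℝ (Fin n)) : Matrix (Fin n) (Fin k) ℝ :=
  of fun i c ↦ g c i

lemma continuous_frameMatrix :
    Continuous (frameMatrix : (Fin k → EuclideanSpace ℝ (Fin n)) → Matrix (Fin n) (Fin k) ℝ) :=
  continuous_matrix fun i c ↦ (EuclideanSpace.proj i).continuous.comp (continuous_apply c)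

/-- The law of an `n × k` matrix with independent standard Gaussian entries. -/
noncomputable def gaussianMatrix (n k : ℕ) : Measure (Matrix (Fin n) (Fin k) ℝ) :=
  (Measure.pi fun _ : Fin k ↦ stdGaussian (EuclideanSpace ℝ (Fin n))).map frameMatrix

instance (n k : ℕ) : IsProbabilityMeasure (gaussianMatrix n k) :=
  Measure.isProbabilityMeasure_map continuous_frameMatrix.aemeasurable

lemma measurePreserving_frameMatrix :
    MeasurePreserving frameMatrix
      (Measure.pi fun _ : Fin k ↦ stdGaussian (EuclideanSpace ℝ (Fin n))) (gaussianMatrix n k) :=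
  ⟨continuous_frameMatrix.measurable, rfl⟩

lemma measurePreserving_toEuclideanCLM {U : Matrix (Fin n) (Fin n) ℝ} (hU : Uᵀ * U = 1) :
    MeasurePreserving (toEuclideanCLM (n := Fin n) (𝕜 := ℝ) U)
      (stdGaussian (EuclideanSpace ℝ (Fin n))) (stdGaussian (EuclideanSpace ℝ (Fin n))) := by
  set T := toEuclideanCLM (n := Fin n) (𝕜 := ℝ) U with hT
  have hTT : T * star T = 1 := by
    rw [hT, ← map_star, ← map_mul, star_eq_conjTranspose, conjTranspose_eq_transpose_of_trivial,
      mul_eq_one_comm.1 hU, map_one]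
  refine ⟨by fun_prop, map_stdGaussian_of_adjoint_isometry T
    (ContinuousLinearMap.adjoint T)
    (fun x t ↦ (ContinuousLinearMap.adjoint_inner_right T x t).symm) fun t ↦ ?_⟩
  have e : ‖ContinuousLinearMap.adjoint T t‖ ^ 2 = ‖t‖ ^ 2 := by
    rw [← real_inner_self_eq_norm_sq, ← real_inner_self_eq_norm_sq,
      ContinuousLinearMap.adjoint_inner_right]
    exact congrArg (fun y ↦ ⟪y, t⟫) (DFunLike.congr_fun hTT t)
  exact (sq_eq_sq₀ (norm_nonneg _) (norm_nonneg _)).1 e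

lemma gaussianMatrix_map_mul_left (U : Matrix (Fin n) (Fin n) ℝ) (hU : Uᵀ * U = 1) :
    (gaussianMatrix n k).map (fun M ↦ U * M) = gaussianMatrix n k := by
  have mp := measurePreserving_pi
    (fun _ : Fin k ↦ stdGaussian (EuclideanSpace ℝ (Fin n)))
    (fun _ : Fin k ↦ stdGaussian (EuclideanSpace ℝ (Fin n)))
    (fun _ ↦ measurePreserving_toEuclideanCLM hU)
  have e : (fun M : Matrix (Fin n) (Fin k) ℝ ↦ U * M) ∘ frameMatrix =
      frameMatrix ∘ fun g c ↦ toEuclideanCLM (n := Fin n) (𝕜 := ℝ) U (g c) := by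
    ext g i c
    simp [frameMatrix, mul_apply, mulVec, dotProduct]
  have hm : Measurable fun M : Matrix (Fin n) (Fin k) ℝ ↦ U * M :=
    (continuous_const.matrix_mul continuous_id).measurable
  conv_lhs => rw [gaussianMatrix]
  rw [Measure.map_map hm continuous_frameMatrix.measurable, e,
    ← Measure.map_map continuous_frameMatrix.measurable mp.measurable, mp.map_eq, gaussianMatrix]

lemma frameMatrix_transpose_mul_self {q : Fin k → EuclideanSpace ℝ (Fin n)}
    (hq : Orthonormal ℝ q) : (frameMatrix q)ᵀ * frameMatrix q = 1 := by
  ext c d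
  rw [mul_apply, one_apply, ← orthonormal_iff_ite.1 hq c d, PiLp.inner_apply]
  simp [frameMatrix, mul_comm]

/-- Comparison of the mean of a seminorm of a uniformly distributed frame with its mean at a
Gaussian matrix. -/
lemma sum_chiMean_mul_integral_le (hk : 0 < k) (hkn : k ≤ n)
    (f : Seminorm ℝ (Matrix (Fin n) (Fin k) ℝ)) (hf : Continuous f)
    (hR : ∀ V : Matrix (Fin k) (Fin k) ℝ, Vᵀ * V = 1 → ∀ M, f (M * V) = f M)
    (hfγ : Integrable f (gaussianMatrix n k))
    (μ : Measure (Matrix (Fin n) (Fin k) ℝ)) [IsProbabilityMeasure μ]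
    (hμs : ∀ᵐ Q ∂μ, Qᵀ * Q = 1)
    (hμ : ∀ U : Matrix (Fin n) (Fin n) ℝ, Uᵀ * U = 1 → μ.map (fun Q ↦ U * Q) = μ)
    (hfμ : Integrable f μ) :
    (∑ c ∈ Finset.range k, chiMean (n - c)) * ∫ Q, f Q ∂μ ≤
      k * ∫ M, f M ∂(gaussianMatrix n k) := by
  have : NeZero k := ⟨hk.ne'⟩
  set h := averagedSeminorm f hf with hh
  have hhL : ∀ W : Matrix (Fin n) (Fin n) ℝ, Wᵀ * W = 1 → ∀ M, h (W * M) = h M :=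
    fun W hW M ↦ averagedSeminorm_mul_left f hf hW M
  have hhR : ∀ V : Matrix (Fin k) (Fin k) ℝ, Vᵀ * V = 1 → ∀ M, h (M * V) = h M :=
    fun V hV M ↦ averagedSeminorm_mul_right f hf hR hV M
  have e₁ : ∫ Q, f Q ∂μ = h (firstColumns hkn) := by
    rw [← integral_averagedSeminorm f hf μ hμ hfμ]
    have : ∀ᵐ Q ∂μ, averagedSeminorm f hf Q = h (firstColumns hkn) := by
      filter_upwards [hμs] with Q hQ
      obtain ⟨W, hW, rfl⟩ := exists_orthogonal_mul_firstColumns hkn hQ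
      exact hhL W hW _
    rw [integral_congr_ae this, integral_const, probReal_univ, one_smul]
  have e₂ : ∫ M, f M ∂(gaussianMatrix n k) = ∫ M, h M ∂(gaussianMatrix n k) :=
    (integral_averagedSeminorm f hf _ gaussianMatrix_map_mul_left hfγ).symm
  have ih : Integrable h (gaussianMatrix n k) :=
    integrable_averagedSeminorm f hf _ gaussianMatrix_map_mul_left hfγ
  have ih' := measurePreserving_frameMatrix.integrable_comp_of_integrable ih
  have e₃ : ∫ M, h M ∂(gaussianMatrix n k) = ∫ g, h (frameMatrix g)
      ∂(Measure.pi fun _ : Fin k ↦ stdGaussian (EuclideanSpace ℝ (Fin n))) :=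
    integral_map continuous_frameMatrix.aemeasurable ih.1
  rw [e₁, e₂, e₃]
  rcases (apply_nonneg h (firstColumns hkn)).eq_or_lt with h0 | h0
  · rw [← h0, mul_zero]
    exact mul_nonneg k.cast_nonneg (integral_nonneg fun g ↦ apply_nonneg h _)
  · have := sum_chiMean_le_integral (E := EuclideanSpace ℝ (Fin n)) (k := k)
      (K := fun g ↦ k * h (frameMatrix g) / h (firstColumns hkn)) (by simpa using hkn)
      ((ih'.const_mul _).div_const _) (.of_forall fun g q hq ↦ by
        rw [le_div_iff₀ h0]
        have e : ∑ c, ⟪q c, g c⟫ = ∑ c, ∑ i, frameMatrix q i c * frameMatrix g i c := by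
          simp [PiLp.inner_apply, frameMatrix, mul_comm]
        rw [e]
        exact frame_pairing_mul_seminorm_firstColumns_le hkn h hhL hhR
          (frameMatrix_transpose_mul_self hq) (frameMatrix g))
    rw [integral_div, integral_const_mul, le_div_iff₀ h0] at this
    simpa using this

end GaussianMatrix

section ChiMeanSum

lemma two_thirds_cube_sub_cube_le {a b : ℝ} (ha : 0 < a) (hb : 0 ≤ b) (hab : a ^ 2 - b ^ 2 = 1) :
    2 / 3 * (a ^ 3 - b ^ 3) ≤ √(a ^ 2 - 1 / 2) := by
  refine Real.le_sqrt_of_sq_le ?_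
  have hs : a ^ 2 - 1 / 2 = (a ^ 2 + b ^ 2) / 2 := by linarith
  have e : (a ^ 3 - b ^ 3) * (a + b) = a ^ 2 + b ^ 2 + a * b := by
    linear_combination (a ^ 2 + a * b + b ^ 2) * hab
  have hp : 0 < (a + b) ^ 2 := by positivity
  rw [hs, ← mul_le_mul_iff_left₀ hp]
  have : (2 / 3 * (a ^ 3 - b ^ 3)) ^ 2 * (a + b) ^ 2 = 4 / 9 * (a ^ 2 + b ^ 2 + a * b) ^ 2 := by
    rw [← e]; ring
  rw [this]
  nlinarith [mul_nonneg (by positivity : 0 ≤ a ^ 2 + b ^ 2 + 4 * (a * b)) (sq_nonneg (a - b))]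

lemma two_thirds_cube_sub_cube_le_chiMean {m : ℕ} (hm : 0 < m) :
    2 / 3 * (√m ^ 3 - √((m : ℝ) - 1) ^ 3) ≤ chiMean m := by
  have h1 : (1 : ℝ) ≤ m := by exact_mod_cast hm
  have h := two_thirds_cube_sub_cube_le (a := √m) (b := √((m : ℝ) - 1)) (by positivity)
    (by positivity) (by rw [Real.sq_sqrt (by positivity), Real.sq_sqrt (by linarith)]; ring)
  refine h.trans (Real.sqrt_le_iff.2 ⟨(chiMean_pos hm).le, ?_⟩)
  rw [Real.sq_sqrt (by positivity)]
  exact sub_half_le_chiMean_sq hm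

lemma two_thirds_cube_sub_cube_le_sum_chiMean {n k : ℕ} (hkn : k ≤ n) :
    2 / 3 * (√n ^ 3 - √((n : ℝ) - k) ^ 3) ≤ ∑ c ∈ Finset.range k, chiMean (n - c) := by
  induction k with
  | zero => simp
  | succ k ih =>
    have h1 := ih (by omega)
    have h2 := two_thirds_cube_sub_cube_le_chiMean (m := n - k) (by omega)
    rw [Nat.cast_sub (by omega)] at h2
    rw [Finset.sum_range_succ]
    push_cast
    rw [← sub_sub]
    linarith

lemma mul_sqrt_le_sum_chiMean {n k : ℕ} (hn : 0 < n) (hkn : k ≤ n) :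
    k * √n ≤ (1 + (k : ℝ) / (2 * n)) * ∑ c ∈ Finset.range k, chiMean (n - c) := by
  have hn' : (0 : ℝ) < n := by exact_mod_cast hn
  have hk' : (k : ℝ) ≤ n := by exact_mod_cast hkn
  refine le_trans ?_ (mul_le_mul_of_nonneg_left
    (two_thirds_cube_sub_cube_le_sum_chiMean hkn) (by positivity))
  set y := √(n : ℝ) with hy
  set z := √((n : ℝ) - k) with hz
  have hy0 : 0 < y := by positivity
  have hz0 : 0 ≤ z := by positivity
  have hyn : y ^ 2 = n := Real.sq_sqrt hn'.le
  have hzn : z ^ 2 = n - k := Real.sq_sqrt (by linarith)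
  have hk : (k : ℝ) = y ^ 2 - z ^ 2 := by linarith
  rw [hk, ← hyn, ← sub_nonneg]
  have : (1 + (y ^ 2 - z ^ 2) / (2 * y ^ 2)) * (2 / 3 * (y ^ 3 - z ^ 3)) - (y ^ 2 - z ^ 2) * y =
      z ^ 2 * (y - z) ^ 2 * (2 * y + z) / (3 * y ^ 2) := by
    field_simp
    ring
  rw [this]
  positivity

end ChiMeanSum

section SpectralNorm

variable {n k j : ℕ}

lemma euclNorm_eq_norm {m : ℕ} (v : Fin m → ℝ) : euclNorm v = ‖WithLp.toLp 2 v‖ := by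
  simp [euclNorm, EuclideanSpace.norm_eq]

lemma specNorm_eq_norm_columnsOp (M : Matrix (Fin j) (Fin k) ℝ) :
    specNorm M = ‖columnsOp fun c ↦ (WithLp.toLp 2 fun i ↦ M i c : EuclideanSpace ℝ (Fin j))‖ := by
  have e : ∀ x : Fin k → ℝ, WithLp.toLp 2 (M *ᵥ x) =
      columnsOp (fun c ↦ (WithLp.toLp 2 fun i ↦ M i c : EuclideanSpace ℝ (Fin j)))
        (WithLp.toLp 2 x) := by
    intro x
    ext i
    simp [columnsOp_apply, mulVec, dotProduct, mul_comm]
  rw [← ContinuousLinearMap.sSup_unitClosedBall_eq_norm, specNorm]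
  congr 1
  ext r
  simp only [euclNorm_eq_norm, e, Set.mem_ofPred_eq, Set.mem_image, Metric.mem_closedBall,
    dist_zero_right]
  constructor
  · rintro ⟨x, hx, rfl⟩
    exact ⟨_, hx, rfl⟩
  · rintro ⟨x, hx, rfl⟩
    exact ⟨WithLp.ofLp x, hx, rfl⟩

lemma euclNorm_mulVec {V : Matrix (Fin k) (Fin k) ℝ} (hV : Vᵀ * V = 1) (x : Fin k → ℝ) :
    euclNorm (V *ᵥ x) = euclNorm x := by
  have e : ∀ y : Fin k → ℝ, ∑ i, y i ^ 2 = y ⬝ᵥ y := fun y ↦ by simp [dotProduct, sq]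
  rw [euclNorm, euclNorm, e, e, dotProduct_mulVec, ← mulVec_transpose, mulVec_mulVec, hV,
    one_mulVec]

lemma specNorm_mul_right {V : Matrix (Fin k) (Fin k) ℝ} (hV : Vᵀ * V = 1)
    (M : Matrix (Fin j) (Fin k) ℝ) : specNorm (M * V) = specNorm M := by
  unfold specNorm
  congr 1
  ext r
  constructor
  · rintro ⟨x, hx, rfl⟩
    exact ⟨V *ᵥ x, by rwa [euclNorm_mulVec hV], by rw [mulVec_mulVec]⟩
  · rintro ⟨x, hx, rfl⟩
    have hV' : V * Vᵀ = 1 := mul_eq_one_comm.1 hV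
    refine ⟨Vᵀ *ᵥ x, by rwa [euclNorm_mulVec (by rwa [transpose_transpose])], ?_⟩
    rw [mulVec_mulVec, Matrix.mul_assoc, hV', Matrix.mul_one]

/-- The spectral norm of the first `j` rows, as a seminorm. -/
noncomputable def rowsSeminorm (k : ℕ) (hjn : j ≤ n) :
    Seminorm ℝ (Matrix (Fin n) (Fin k) ℝ) :=
  Seminorm.of (fun M ↦ specNorm (M.submatrix (Fin.castLE hjn) id))
    (fun A B ↦ by
      simp only [specNorm_eq_norm_columnsOp]
      refine le_trans (le_of_eq ?_) (norm_add_le _ _)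
      congr 1
      ext x i
      simp [columnsOp_apply, mul_add, Finset.sum_add_distrib])
    (fun c A ↦ by
      simp only [specNorm_eq_norm_columnsOp]
      rw [← norm_smul]
      congr 1
      ext x i
      simp [columnsOp_apply, Finset.mul_sum, mul_left_comm])

lemma rowsSeminorm_apply (hjn : j ≤ n) (M : Matrix (Fin n) (Fin k) ℝ) :
    rowsSeminorm k hjn M = specNorm (M.submatrix (Fin.castLE hjn) id) := rfl

lemma continuous_rowsSeminorm (hjn : j ≤ n) : Continuous (rowsSeminorm k hjn) := by
  have : (rowsSeminorm k hjn : Matrix (Fin n) (Fin k) ℝ → ℝ) = fun M ↦ ‖columnsOp fun c ↦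
      (WithLp.toLp 2 fun i ↦ M (Fin.castLE hjn i) c : EuclideanSpace ℝ (Fin j))‖ := by
    ext M
    rw [rowsSeminorm_apply, specNorm_eq_norm_columnsOp]
    rfl
  rw [this]
  refine (continuous_columnsOp.comp (continuous_pi fun c ↦
    (PiLp.continuous_toLp 2 _).comp (continuous_pi fun i ↦ ?_))).norm
  exact continuous_id.matrix_elem _ _

lemma specNorm_restrictRows (hjn : j ≤ n) (M : Matrix (Fin n) (Fin k) ℝ) :
    specNorm (restrictRows j hjn M) = √((n : ℝ) / j) * rowsSeminorm k hjn M := by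
  rw [← Real.norm_of_nonneg (Real.sqrt_nonneg ((n : ℝ) / j)), ← map_smul_eq_mul]
  rfl

/-- The restriction of a vector to its first `j` coordinates. -/
noncomputable def firstCoordinates (hjn : j ≤ n) :
    EuclideanSpace ℝ (Fin n) →L[ℝ] EuclideanSpace ℝ (Fin j) :=
  LinearMap.toContinuousLinearMap
    { toFun := fun x ↦ WithLp.toLp 2 fun i ↦ x (Fin.castLE hjn i)
      map_add' := fun _ _ ↦ rfl
      map_smul' := fun _ _ ↦ rfl }

lemma firstCoordinates_apply (hjn : j ≤ n) (x : EuclideanSpace ℝ (Fin n)) (i : Fin j) :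
    firstCoordinates hjn x i = x (Fin.castLE hjn i) := rfl

lemma map_firstCoordinates_stdGaussian (hjn : j ≤ n) :
    (stdGaussian (EuclideanSpace ℝ (Fin n))).map (firstCoordinates hjn) =
      stdGaussian (EuclideanSpace ℝ (Fin j)) := by
  have hinj : Function.Injective (Fin.castLE hjn) := Fin.castLE_injective hjn
  refine map_stdGaussian_of_adjoint_isometry _
    (fun t ↦ WithLp.toLp 2 (Function.extend (Fin.castLE hjn) t 0)) (fun x t ↦ ?_) fun t ↦ ?_
  · rw [PiLp.inner_apply, PiLp.inner_apply]
    refine Fintype.sum_of_injective (Fin.castLE hjn) hinj _ _ (fun i hi ↦ ?_) fun i ↦ ?_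
    · simp [Function.extend_apply' _ _ _ hi]
    · simp [firstCoordinates_apply, hinj.extend_apply]
  · rw [EuclideanSpace.norm_eq, EuclideanSpace.norm_eq]
    congr 1
    refine (Fintype.sum_of_injective (Fin.castLE hjn) hinj _ _ (fun i hi ↦ ?_) fun i ↦ ?_).symm
    · simp [Function.extend_apply' _ _ _ hi]
    · simp [hinj.extend_apply]

lemma measurePreserving_firstCoordinates (k : ℕ) (hjn : j ≤ n) :
    MeasurePreserving (fun (g : Fin k → EuclideanSpace ℝ (Fin n)) c ↦ firstCoordinates hjn (g c))
      (Measure.pi fun _ : Fin k ↦ stdGaussian (EuclideanSpace ℝ (Fin n)))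
      (Measure.pi fun _ : Fin k ↦ stdGaussian (EuclideanSpace ℝ (Fin j))) :=
  measurePreserving_pi _ _ fun _ ↦
    ⟨(firstCoordinates hjn).continuous.measurable, map_firstCoordinates_stdGaussian hjn⟩

lemma rowsSeminorm_frameMatrix (hjn : j ≤ n) (g : Fin k → EuclideanSpace ℝ (Fin n)) :
    rowsSeminorm k hjn (frameMatrix g) = ‖columnsOp fun c ↦ firstCoordinates hjn (g c)‖ := by
  rw [rowsSeminorm_apply, specNorm_eq_norm_columnsOp]
  rfl

lemma integrable_norm_columnsOp :
    Integrable (fun G : Fin k → EuclideanSpace ℝ (Fin j) ↦ ‖columnsOp G‖)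
      (Measure.pi fun _ : Fin k ↦ stdGaussian (EuclideanSpace ℝ (Fin j))) := by
  refine Integrable.mono' (g := fun G ↦ ∑ c, ‖G c‖) (integrable_finsetSum _ fun c _ ↦ ?_)
    continuous_columnsOp.norm.aestronglyMeasurable (.of_forall fun G ↦ ?_)
  · exact (measurePreserving_eval (fun _ : Fin k ↦ stdGaussian (EuclideanSpace ℝ (Fin j)))
      c).integrable_comp_of_integrable
      (integrable_norm_apply_stdGaussian (ContinuousLinearMap.id ℝ (EuclideanSpace ℝ (Fin j))))
  · rw [norm_norm]
    exact norm_columnsOp_le G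

lemma integrable_rowsSeminorm (hjn : j ≤ n) :
    Integrable (rowsSeminorm k hjn) (gaussianMatrix n k) := by
  rw [gaussianMatrix, integrable_map_measure (continuous_rowsSeminorm hjn).aestronglyMeasurable
    continuous_frameMatrix.aemeasurable]
  refine ((measurePreserving_firstCoordinates k hjn).integrable_comp_of_integrable
    integrable_norm_columnsOp).congr (.of_forall fun g ↦ ?_)
  exact (rowsSeminorm_frameMatrix hjn g).symm

lemma integral_rowsSeminorm_le (hk : 0 < k) (hj : 0 < j) (hjn : j ≤ n) :
    ∫ M, rowsSeminorm k hjn M ∂(gaussianMatrix n k) ≤ √k + √j := by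
  have : Nonempty (Fin j) := ⟨⟨0, hj⟩⟩
  have mp := measurePreserving_firstCoordinates k hjn
  rw [gaussianMatrix, integral_map continuous_frameMatrix.aemeasurable
    (continuous_rowsSeminorm hjn).aestronglyMeasurable]
  simp_rw [rowsSeminorm_frameMatrix]
  have h := integral_norm_columnsOp_le (F := EuclideanSpace ℝ (Fin j)) hk
  rw [finrank_euclideanSpace_fin, ← mp.map_eq, integral_map mp.measurable.aemeasurable
    continuous_columnsOp.norm.aestronglyMeasurable] at h
  exact h

end SpectralNorm

/-- **Spectral norm of a submatrix of a random `k`-frame.**  If `μ` is the Haar probability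
measure on the Stiefel manifold `V_k^n` and `L_j` restricts to the first `j` rows and
rescales by `√(n/j)`, then `E ‖L_j(Q)‖ ≤ (1 + k/(2n)) (1 + √(k/j))`. -/
theorem expected_spectral_norm_submatrix
    (n k j : ℕ) (hn : 0 < n) (hk : 0 < k) (hj : 0 < j) (hkn : k ≤ n) (hjn : j ≤ n)
    (μ : Measure (Matrix (Fin n) (Fin k) ℝ)) [IsProbabilityMeasure μ]
    (hμ_stiefel : ∀ᵐ Q ∂μ, Qᵀ * Q = 1)
    (hμ_inv : ∀ U : Matrix (Fin n) (Fin n) ℝ, Uᵀ * U = 1 →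
      μ.map (fun Q => U * Q) = μ) :
    ∫ Q, specNorm (restrictRows j hjn Q) ∂μ
      ≤ (1 + (k : ℝ) / (2 * n)) * (1 + Real.sqrt ((k : ℝ) / j)) := by
  simp_rw [specNorm_restrictRows]
  rw [integral_const_mul]
  set X := ∫ Q, rowsSeminorm k hjn Q ∂μ with hX
  set β : ℝ := 1 + (k : ℝ) / (2 * n) with hβ
  have hβ0 : 0 < β := by positivity
  by_cases h_int : Integrable (rowsSeminorm k hjn) μ
  · have h1 := sum_chiMean_mul_integral_le hk hkn (rowsSeminorm k hjn)
      (continuous_rowsSeminorm hjn)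
      (fun V hV M ↦ specNorm_mul_right hV (M.submatrix (Fin.castLE hjn) id))
      (integrable_rowsSeminorm hjn) μ hμ_stiefel hμ_inv h_int
    have h2 := mul_sqrt_le_sum_chiMean hn hkn
    have h3 := integral_rowsSeminorm_le hk hj hjn
    have hX0 : 0 ≤ X := integral_nonneg fun Q ↦ apply_nonneg _ Q
    have hk' : (0 : ℝ) < k := by exact_mod_cast hk
    have hsj : 0 < √(j : ℝ) := by positivity
    have h4 : k * (√n * X) ≤ k * (β * (√k + √j)) := by
      calc k * (√n * X) = k * √n * X := by ring
        _ ≤ β * (∑ c ∈ Finset.range k, chiMean (n - c)) * X := by gcongr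
        _ = β * ((∑ c ∈ Finset.range k, chiMean (n - c)) * X) := by ring
        _ ≤ β * (k * (√k + √j)) :=
          mul_le_mul_of_nonneg_left (h1.trans (mul_le_mul_of_nonneg_left h3 hk'.le)) hβ0.le
        _ = k * (β * (√k + √j)) := by ring
    have h5 := le_of_mul_le_mul_left h4 hk'
    rw [Real.sqrt_div (by positivity), Real.sqrt_div (by positivity), ← mul_le_mul_iff_left₀ hsj]
    calc √n / √j * X * √j = √n * X := by field_simp
      _ ≤ β * (√k + √j) := h5
      _ = β * (1 + √k / √j) * √j := by field_simp; ring
  · rw [hX, integral_undef h_int, mul_zero]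
    positivity
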